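/- arXiv:1810.01659 — 2 statements merged into one kernel-verified Lean document; each statement's English description precedes it below -/
import Mathlib

section
/- Let V : ℝ³∖{0} → ℂ^{4×4} be measurable with V(x) Hermitian and |x| ‖V(x)‖ ≤ 1 for a.e. x ∈ ℝ³. Then for every ψ ∈ C_c^∞(ℝ³;ℂ⁴) and every R > 0: ∫_{ℝ³} |x| |(−iα·∇ψ)(x)|² dx − ∫_{ℝ³} |x| |V(x)ψ(x)|² dx ≥ (1/4) ∫_{ℝ³} |ψ(x) − (R/|x|) ψ(R x/|x|)|² / (|x| (log(|x|/R))²) dx. -/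
open MeasureTheory Real Filter

noncomputable section

abbrev E3 := EuclideanSpace ℝ (Fin 3)
abbrev C4 := EuclideanSpace ℂ (Fin 4)

/-- Pauli matrices. -/
def pauli : Fin 3 → Matrix (Fin 2) (Fin 2) ℂ
  | 0 => !![0, 1; 1, 0]
  | 1 => !![0, -Complex.I; Complex.I, 0]
  | 2 => !![1, 0; 0, -1]

/-- Dirac matrices αⱼ = [[0, σⱼ], [σⱼ, 0]]. -/
def diracAlpha (j : Fin 3) : Matrix (Fin 4) (Fin 4) ℂ :=
  Matrix.reindex finSumFinEquiv finSumFinEquiv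
    (Matrix.fromBlocks 0 (pauli j) (pauli j) 0)

/-- Dirac matrix β = [[I₂, 0], [0, -I₂]]. -/
def diracBeta : Matrix (Fin 4) (Fin 4) ℂ :=
  Matrix.reindex finSumFinEquiv finSumFinEquiv
    (Matrix.fromBlocks (1 : Matrix (Fin 2) (Fin 2) ℂ) 0 0 (-1 : Matrix (Fin 2) (Fin 2) ℂ))

/-- Block-diagonal matrix diag(σⱼ, σⱼ) (twice the spin angular momentum matrices). -/
def spinMat (j : Fin 3) : Matrix (Fin 4) (Fin 4) ℂ :=
  Matrix.reindex finSumFinEquiv finSumFinEquiv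
    (Matrix.fromBlocks (pauli j) 0 0 (pauli j))

/-- Action of a 4 × 4 matrix on ℂ⁴ with the Euclidean norm. -/
def mulVecE (M : Matrix (Fin 4) (Fin 4) ℂ) (v : C4) : C4 :=
  Matrix.toEuclideanLin M v

/-- The partial derivative ∂ⱼψ(x). -/
def pderiv3 (j : Fin 3) (ψ : E3 → C4) (x : E3) : C4 :=
  fderiv ℝ ψ x (EuclideanSpace.single j 1)

/-- The free Dirac operator (-iα·∇ψ)(x). -/
def diracD (ψ : E3 → C4) (x : E3) : C4 :=
  (-Complex.I) • ∑ j : Fin 3, mulVecE (diracAlpha j) (pderiv3 j ψ x)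

/-- The radial derivative ∂_rψ(x) = Σⱼ (xⱼ/|x|) ∂ⱼψ(x). -/
def radialDeriv (ψ : E3 → C4) (x : E3) : C4 :=
  ∑ j : Fin 3, (x j / ‖x‖) • pderiv3 j ψ x

/-- The orbital angular momentum (Lⱼψ)(x) = -i (x × ∇)ⱼ ψ(x). -/
def angMom (j : Fin 3) (ψ : E3 → C4) (x : E3) : C4 :=
  (-Complex.I) • ((x (j + 1)) • pderiv3 (j + 2) ψ x - (x (j + 2)) • pderiv3 (j + 1) ψ x)

/-- The spin-orbit term (2S·Lψ)(x) = Σⱼ diag(σⱼ,σⱼ) (Lⱼψ)(x). -/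
def twoSL (ψ : E3 → C4) (x : E3) : C4 :=
  ∑ j : Fin 3, mulVecE (spinMat j) (angMom j ψ x)

/-- A function vanishing at `R` with bounded derivative is controlled by `log (r / R)`. -/
lemma exists_norm_sub_le_mul_abs_log {F : Type*} [NormedAddCommGroup F] [NormedSpace ℝ F]
    {f f' : ℝ → F} (hf : ∀ r, HasDerivAt f (f' r) r) (hf' : Continuous f')
    {a b R : ℝ} (ha : 0 < a) (hR : R ∈ Set.Icc a b) :
    ∃ M, 0 ≤ M ∧ ∀ r ∈ Set.Icc a b, ‖f r - f R‖ ≤ M * |Real.log (r / R)| := by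
  obtain ⟨C, hC⟩ := (isCompact_Icc (a := a) (b := b)).exists_bound_of_continuousOn hf'.continuousOn
  have hR0 : 0 < R := ha.trans_le hR.1
  have hC0 : 0 ≤ C := (norm_nonneg _).trans (hC R hR)
  refine ⟨C * b, mul_nonneg hC0 (hR0.le.trans hR.2), fun r hr => ?_⟩
  have hr0 : 0 < r := ha.trans_le hr.1
  have hmv : ‖f r - f R‖ ≤ C * ‖r - R‖ :=
    (convex_Icc a b).norm_image_sub_le_of_norm_hasDerivWithin_le
      (fun x _ => (hf x).hasDerivWithinAt) hC hR hr
  have hlog : |r - R| ≤ b * |Real.log (r / R)| := by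
    have hx : 0 < r / R := div_pos hr0 hR0
    have hone := Real.one_sub_inv_le_log_of_pos hx
    have htwo := Real.log_le_sub_one_of_pos hx
    rw [inv_div] at hone
    have hL := abs_nonneg (Real.log (r / R))
    rcases le_total R r with h | h
    · rw [abs_of_nonneg (sub_nonneg.2 h)]
      have : r - R = r * (1 - R / r) := by field_simp
      rw [this]
      calc r * (1 - R / r) ≤ r * |Real.log (r / R)| :=
            mul_le_mul_of_nonneg_left (hone.trans (le_abs_self _)) hr0.le
        _ ≤ _ := mul_le_mul_of_nonneg_right hr.2 hL
    · rw [abs_of_nonpos (sub_nonpos.2 h)]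
      have : -(r - R) = R * (-(r / R - 1)) := by field_simp
      rw [this]
      calc R * (-(r / R - 1)) ≤ R * |Real.log (r / R)| :=
            mul_le_mul_of_nonneg_left ((neg_le_neg htwo).trans (neg_le_abs _)) hR0.le
        _ ≤ _ := mul_le_mul_of_nonneg_right hR.2 hL
  calc _ ≤ C * |r - R| := hmv
    _ ≤ C * (b * |Real.log (r / R)|) := mul_le_mul_of_nonneg_left hlog hC0
    _ = _ := by ring

section Hardy

variable {F : Type*} [NormedAddCommGroup F] [InnerProductSpace ℝ F]

/-- Logarithmic Hardy inequality with the critical remainder, on a compact interval. -/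
lemma hardy_log_Ioc {v v' : ℝ → F} (hv : ∀ r, HasDerivAt v (v' r) r) (hv' : Continuous v')
    {a b R : ℝ} (ha : 0 < a) (haR : a < R) (hRb : R < b) (hb : v b = 0) :
    IntegrableOn (fun r => r * ‖v r‖ ^ 2 +
      1 / 4 * (‖r • v r - R • v R‖ ^ 2 / (r * Real.log (r / R) ^ 2))) (Set.Ioc a b) ∧
    ∫ r in Set.Ioc a b, (r * ‖v r‖ ^ 2 +
      1 / 4 * (‖r • v r - R • v R‖ ^ 2 / (r * Real.log (r / R) ^ 2))) ≤
    ∫ r in Set.Ioc a b, r ^ 3 * ‖v' r‖ ^ 2 := by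
  have hR0 : 0 < R := ha.trans haR
  have hab : a ≤ b := (haR.trans hRb).le
  have hvc : Continuous v := continuous_iff_continuousAt.2 fun r => (hv r).continuousAt
  have hφ : ∀ r, HasDerivAt (fun r : ℝ => r • v r) (r • v' r + (1 : ℝ) • v r) r :=
    fun r => (hasDerivAt_id r).smul (hv r)
  set φ' : ℝ → F := fun r => r • v' r + (1 : ℝ) • v r with hφ'
  have hφ'c : Continuous φ' := by fun_prop
  obtain ⟨M, hM0, hM⟩ := exists_norm_sub_le_mul_abs_log hφ hφ'c ha ⟨haR.le, hRb.le⟩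
  set u : ℝ → F := fun r => r • v r - R • v R with hu
  have huc : Continuous u := by fun_prop
  have hud : ∀ r, HasDerivAt u (φ' r) r := fun r => (hφ r).sub_const _
  set L : ℝ → ℝ := fun r => Real.log (r / R) with hL
  have hLm : Measurable L := by fun_prop
  have hL0 : ∀ r, 0 < r → r ≠ R → L r ≠ 0 := by
    intro r hr hrR h
    rcases Real.log_eq_zero.1 h with h | h | h
    · exact (div_pos hr hR0).ne' h
    · exact hrR ((div_eq_one_iff_eq hR0.ne').1 h)
    · linarith [div_pos hr hR0]
  have hLd : ∀ r, 0 < r → HasDerivAt L (1 / r) r := by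
    intro r hr
    have := ((hasDerivAt_id r).div_const R).log (div_pos hr hR0).ne'
    refine this.congr_deriv ?_
    simp only [id]
    field_simp
  set H : ℝ → ℝ := fun r => ‖u r‖ ^ 2 / (2 * L r) - r ^ 2 * ‖v r‖ ^ 2 with hH
  set H' : ℝ → ℝ := fun r => inner ℝ (u r) (φ' r) / L r - 1 / 2 * (‖u r‖ ^ 2 / (r * L r ^ 2))
    - (2 * r * ‖v r‖ ^ 2 + r ^ 2 * (2 * inner ℝ (v r) (v' r))) with hH'
  have hHd : ∀ r, 0 < r → r ≠ R → HasDerivAt H (H' r) r := by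
    intro r hr hrR
    have hl := hL0 r hr hrR
    have h1 := ((hud r).norm_sq).div ((hLd r hr).const_mul 2) (mul_ne_zero two_ne_zero hl)
    have h2 := (hasDerivAt_pow 2 r).mul ((hv r).norm_sq)
    refine (h1.sub h2).congr_deriv ?_
    simp only [hH']
    field_simp
    ring
  have hHc : ContinuousOn H (Set.Icc a b) := by
    intro r hr
    have hr0 : 0 < r := ha.trans_le hr.1
    by_cases hrR : r = R
    · subst hrR
      have hsq : ContinuousWithinAt (fun s => ‖u s‖ ^ 2 / (2 * L s)) (Set.Icc a b) r := by
        have hur : u r = 0 := by simp [hu]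
        have h0 : (fun s => ‖u s‖ ^ 2 / (2 * L s)) r = 0 := by simp [hur]
        unfold ContinuousWithinAt
        rw [h0]
        have hlim : Tendsto (fun s => M * ‖u s‖) (nhdsWithin r (Set.Icc a b)) (nhds 0) := by
          have : Continuous fun s => M * ‖u s‖ := by fun_prop
          have h := this.continuousWithinAt (s := Set.Icc a b) (x := r)
          unfold ContinuousWithinAt at h
          simpa [hur] using h
        refine squeeze_zero_norm' ?_ hlim
        filter_upwards [self_mem_nhdsWithin] with s hs
        rw [Real.norm_eq_abs, abs_div, abs_of_nonneg (sq_nonneg ‖u s‖), abs_mul, abs_two]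
        refine div_le_of_le_mul₀ (by positivity) (by positivity) ?_
        have := hM s hs
        have hn := norm_nonneg (u s)
        nlinarith [mul_le_mul_of_nonneg_right this hn,
          mul_nonneg (mul_nonneg hM0 (abs_nonneg (L s))) hn]
      exact hsq.sub (by fun_prop)
    · exact (hHd r hr0 hrR).continuousAt.continuousWithinAt
  have hfin : volume (Set.Ioc a b) < ⊤ := measure_Ioc_lt_top
  have hQ : IntegrableOn (fun r => ‖u r‖ ^ 2 / (r * L r ^ 2)) (Set.Ioc a b) := by
    refine Measure.integrableOn_of_bounded (M := M ^ 2 / a) hfin.ne ?_ ?_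
    · have : Measurable fun r => ‖u r‖ ^ 2 :=
        (by fun_prop : Continuous fun r => ‖u r‖ ^ 2).measurable
      exact (this.div (measurable_id.mul (hLm.pow_const 2))).aestronglyMeasurable
    · filter_upwards [ae_restrict_mem measurableSet_Ioc] with r hr
      have hr0 : 0 < r := ha.trans hr.1
      rw [Real.norm_of_nonneg (by positivity)]
      have h1 : ‖u r‖ ^ 2 ≤ M ^ 2 * L r ^ 2 := by
        rw [← sq_abs (L r), ← mul_pow]
        exact pow_le_pow_left₀ (norm_nonneg _) (hM r (Set.Ioc_subset_Icc_self hr)) 2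
      refine div_le_of_le_mul₀ (by positivity) (by positivity) (h1.trans ?_)
      have h2 : M ^ 2 / a * (r * L r ^ 2) = M ^ 2 * L r ^ 2 * (r / a) := by ring
      rw [h2]
      exact le_mul_of_one_le_right (by positivity) ((one_le_div ha).2 hr.1.le)
  have hP : IntegrableOn (fun r => inner ℝ (u r) (φ' r) / L r) (Set.Ioc a b) := by
    obtain ⟨C, hC⟩ := (isCompact_Icc (a := a) (b := b)).exists_bound_of_continuousOn
      hφ'c.continuousOn
    have hC0 : 0 ≤ C := (norm_nonneg _).trans (hC a ⟨le_rfl, hab⟩)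
    refine Measure.integrableOn_of_bounded (M := M * C) hfin.ne ?_ ?_
    · have : Measurable fun r => (inner ℝ (u r) (φ' r) : ℝ) :=
        (huc.inner hφ'c).measurable
      exact (this.div hLm).aestronglyMeasurable
    · filter_upwards [ae_restrict_mem measurableSet_Ioc] with r hr
      have hr' := Set.Ioc_subset_Icc_self hr
      rw [norm_div]
      refine div_le_of_le_mul₀ (norm_nonneg _) (by positivity) ?_
      calc ‖(inner ℝ (u r) (φ' r) : ℝ)‖ ≤ ‖u r‖ * ‖φ' r‖ := norm_inner_le_norm _ _
        _ ≤ (M * |L r|) * C :=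
          mul_le_mul (hM r hr') (hC r hr') (norm_nonneg _) (by positivity)
        _ = M * C * ‖L r‖ := by rw [Real.norm_eq_abs]; ring
  have hcont : ∀ f : ℝ → ℝ, Continuous f → IntegrableOn f (Set.Ioc a b) := fun f hf =>
    hf.integrableOn_Ioc
  have hS : IntegrableOn (fun r => r * ‖v r‖ ^ 2 + 1 / 4 * (‖u r‖ ^ 2 / (r * L r ^ 2)))
      (Set.Ioc a b) := (hcont _ (by fun_prop)).add (hQ.const_mul _)
  have hvv : Continuous fun r => (inner ℝ (v r) (v' r) : ℝ) := hvc.inner hv'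
  have hH'i : IntegrableOn H' (Set.Ioc a b) :=
    (hP.sub (hQ.const_mul _)).sub (hcont _ (by fun_prop))
  refine ⟨hS, ?_⟩
  have hFTC : ∫ r in Set.Ioc a b, H' r = H b - H a := by
    rw [← intervalIntegral.integral_of_le hab]
    refine integral_eq_of_hasDerivAt_off_countable_of_le H H' hab (s := {R})
      (Set.countable_singleton R) hHc (fun r hr => hHd r (ha.trans hr.1.1) hr.2) ?_
    exact (intervalIntegrable_iff_integrableOn_Ioc_of_le hab).2 hH'i
  have hHb : 0 ≤ H b := by
    have : 0 ≤ L b := Real.log_nonneg ((one_le_div hR0).2 hRb.le)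
    simp only [hH, hb, norm_zero]
    have : 0 ≤ ‖u b‖ ^ 2 / (2 * L b) := by positivity
    simpa using this
  have hHa : H a ≤ 0 := by
    have : L a ≤ 0 := Real.log_nonpos (div_pos ha hR0).le ((div_le_one hR0).2 haR.le)
    have h1 : ‖u a‖ ^ 2 / (2 * L a) ≤ 0 :=
      div_nonpos_of_nonneg_of_nonpos (by positivity) (by linarith)
    have h2 : 0 ≤ a ^ 2 * ‖v a‖ ^ 2 := by positivity
    simp only [hH]
    linarith
  have hmono : ∫ r in Set.Ioc a b,
      ((r * ‖v r‖ ^ 2 + 1 / 4 * (‖u r‖ ^ 2 / (r * L r ^ 2))) + H' r) ≤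
      ∫ r in Set.Ioc a b, r ^ 3 * ‖v' r‖ ^ 2 := by
    refine setIntegral_mono_ae_restrict (hS.add hH'i) (hcont _ (by fun_prop)) ?_
    have hne : ∀ᵐ r ∂(volume.restrict (Set.Ioc a b)), r ≠ R :=
      ae_restrict_of_ae (by simp [ae_iff])
    filter_upwards [ae_restrict_mem measurableSet_Ioc, hne] with r hr hrR
    have hr0 : 0 < r := ha.trans hr.1
    have hl := hL0 r hr0 hrR
    have hsq : 0 ≤ r * ‖φ' r - (1 / (2 * r * L r)) • u r‖ ^ 2 := by positivity
    rw [norm_sub_sq_real, inner_smul_right, norm_smul, mul_pow, Real.norm_eq_abs, sq_abs,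
      real_inner_comm] at hsq
    have hexp : ‖φ' r‖ ^ 2 = r ^ 2 * ‖v' r‖ ^ 2 + 2 * (r * inner ℝ (v r) (v' r)) + ‖v r‖ ^ 2 := by
      simp only [hφ', one_smul]
      rw [norm_add_sq_real, norm_smul, mul_pow, Real.norm_eq_abs, sq_abs, inner_smul_left,
        real_inner_comm]
      simp
    have key : r ^ 3 * ‖v' r‖ ^ 2 -
        ((r * ‖v r‖ ^ 2 + 1 / 4 * (‖u r‖ ^ 2 / (r * L r ^ 2))) + H' r) =
        r * (‖φ' r‖ ^ 2 - 2 * (1 / (2 * r * L r) * inner ℝ (u r) (φ' r)) +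
          (1 / (2 * r * L r)) ^ 2 * ‖u r‖ ^ 2) := by
      rw [hexp]
      simp only [hH']
      field_simp
      ring
    linarith
  rw [integral_add hS hH'i, hFTC] at hmono
  linarith

/-- Logarithmic Hardy inequality with the critical remainder, on the half-line. -/
lemma hardy_log_Ioi {v v' : ℝ → F} (hv : ∀ r, HasDerivAt v (v' r) r) (hv' : Continuous v')
    {R b : ℝ} (hR : 0 < R) (hb : ∀ r, b ≤ r → v r = 0) :
    ∫⁻ r in Set.Ioi (0 : ℝ), ENNReal.ofReal (r * ‖v r‖ ^ 2 +
      1 / 4 * (‖r • v r - R • v R‖ ^ 2 / (r * Real.log (r / R) ^ 2))) ≤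
    ∫⁻ r in Set.Ioi (0 : ℝ), ENNReal.ofReal (r ^ 3 * ‖v' r‖ ^ 2) := by
  have hvc : Continuous v := continuous_iff_continuousAt.2 fun r => (hv r).continuousAt
  have hcover : AECover (volume.restrict (Set.Ioi (0 : ℝ))) atTop
      fun n : ℕ => Set.Ioc ((n : ℝ) + 1)⁻¹ (n : ℝ) := by
    refine ⟨?_, fun _ => measurableSet_Ioc⟩
    filter_upwards [ae_restrict_mem measurableSet_Ioi] with r hr
    filter_upwards [tendsto_natCast_atTop_atTop.eventually (eventually_ge_atTop r),
      (tendsto_one_div_add_atTop_nhds_zero_nat (𝕜 := ℝ)).eventually (eventually_lt_nhds hr)]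
      with n h1 h2
    exact ⟨by simpa using h2, h1⟩
  have hmeas : Measurable fun r => ENNReal.ofReal (r * ‖v r‖ ^ 2 +
      1 / 4 * (‖r • v r - R • v R‖ ^ 2 / (r * Real.log (r / R) ^ 2))) := by
    have h1 : Measurable fun r => r * ‖v r‖ ^ 2 :=
      (by fun_prop : Continuous fun r => r * ‖v r‖ ^ 2).measurable
    have h2 : Measurable fun r => ‖r • v r - R • v R‖ ^ 2 :=
      (by fun_prop : Continuous fun r => ‖r • v r - R • v R‖ ^ 2).measurable
    fun_prop
  refine le_of_tendsto (hcover.lintegral_tendsto_of_nat hmeas.aemeasurable) ?_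
  filter_upwards [tendsto_natCast_atTop_atTop.eventually (eventually_ge_atTop b),
    tendsto_natCast_atTop_atTop.eventually (eventually_gt_atTop R),
    (tendsto_one_div_add_atTop_nhds_zero_nat (𝕜 := ℝ)).eventually (eventually_lt_nhds hR)]
    with n h1 h2 h3
  have ha : 0 < ((n : ℝ) + 1)⁻¹ := by positivity
  obtain ⟨hi, hle⟩ := hardy_log_Ioc hv hv' ha (by simpa using h3) h2 (hb n h1)
  have hsub : Set.Ioc ((n : ℝ) + 1)⁻¹ (n : ℝ) ⊆ Set.Ioi 0 := fun r hr => ha.trans hr.1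
  rw [Measure.restrict_restrict measurableSet_Ioc, Set.inter_eq_left.2 hsub]
  have hpos : ∀ᵐ r ∂(volume.restrict (Set.Ioc ((n : ℝ) + 1)⁻¹ (n : ℝ))), 0 < r := by
    filter_upwards [ae_restrict_mem measurableSet_Ioc] with r hr using hsub hr
  have hcont : IntegrableOn (fun r => r ^ 3 * ‖v' r‖ ^ 2) (Set.Ioc ((n : ℝ) + 1)⁻¹ (n : ℝ)) :=
    (by fun_prop : Continuous fun r => r ^ 3 * ‖v' r‖ ^ 2).integrableOn_Ioc
  rw [← ofReal_integral_eq_lintegral_ofReal hi (hpos.mono fun r hr => by positivity)]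
  calc _ ≤ ENNReal.ofReal (∫ r in Set.Ioc ((n : ℝ) + 1)⁻¹ (n : ℝ), r ^ 3 * ‖v' r‖ ^ 2) :=
        ENNReal.ofReal_le_ofReal hle
    _ = ∫⁻ r in Set.Ioc ((n : ℝ) + 1)⁻¹ (n : ℝ), ENNReal.ofReal (r ^ 3 * ‖v' r‖ ^ 2) :=
        ofReal_integral_eq_lintegral_ofReal hcont (hpos.mono fun r hr => by positivity)
    _ ≤ _ := lintegral_mono_set hsub

end Hardy

/-- The partial derivative of a scalar function. -/
def partialDeriv (j : Fin 3) (f : E3 → ℝ) (x : E3) : ℝ :=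
  fderiv ℝ f x (EuclideanSpace.single j 1)

/-- The Jacobian determinant of `(h, f, g)`. -/
def jacobianDet (h f g : E3 → ℝ) (x : E3) : ℝ :=
  ∑ j : Fin 3, partialDeriv j h x *
    (partialDeriv (j + 1) f x * partialDeriv (j + 2) g x -
      partialDeriv (j + 2) f x * partialDeriv (j + 1) g x)

lemma contDiff_partialDeriv {f : E3 → ℝ} (hf : ContDiff ℝ (⊤ : ℕ∞) f) (j : Fin 3) :
    ContDiff ℝ (⊤ : ℕ∞) (partialDeriv j f) :=
  (hf.fderiv_right (m := (⊤ : ℕ∞)) (by simp)).clm_apply contDiff_const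

lemma hasCompactSupport_partialDeriv {f : E3 → ℝ} (hf : HasCompactSupport f) (j : Fin 3) :
    HasCompactSupport (partialDeriv j f) :=
  hf.fderiv_apply (𝕜 := ℝ) _

lemma partialDeriv_comm {f : E3 → ℝ} (hf : ContDiff ℝ (⊤ : ℕ∞) f) (i j : Fin 3) (x : E3) :
    partialDeriv i (partialDeriv j f) x = partialDeriv j (partialDeriv i f) x := by
  have hd : DifferentiableAt ℝ (fderiv ℝ f) x :=
    (hf.fderiv_right (m := (⊤ : ℕ∞)) (by simp)).differentiable (by simp) x
  have hsymm : IsSymmSndFDerivAt ℝ f x :=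
    hf.contDiffAt.isSymmSndFDerivAt (by
      rw [minSmoothness_of_isRCLikeNormedField]
      exact WithTop.coe_le_coe.2 le_top)
  have key : ∀ i j, partialDeriv i (partialDeriv j f) x =
      fderiv ℝ (fderiv ℝ f) x (EuclideanSpace.single i 1) (EuclideanSpace.single j 1) := by
    intro i j
    have : partialDeriv j f = fun y => fderiv ℝ f y (EuclideanSpace.single j 1) := rfl
    rw [partialDeriv, this, fderiv_clm_apply hd (differentiableAt_const _)]
    simp
  rw [key, key]
  exact hsymm _ _

lemma partialDeriv_mul_sub {f g p q : E3 → ℝ} (hf : ContDiff ℝ (⊤ : ℕ∞) f)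
    (hg : ContDiff ℝ (⊤ : ℕ∞) g) (hp : ContDiff ℝ (⊤ : ℕ∞) p) (hq : ContDiff ℝ (⊤ : ℕ∞) q)
    (j : Fin 3) (x : E3) :
    partialDeriv j (fun y => f y * g y - p y * q y) x =
      partialDeriv j f x * g x + f x * partialDeriv j g x -
        (partialDeriv j p x * q x + p x * partialDeriv j q x) := by
  have d : ∀ {f : E3 → ℝ}, ContDiff ℝ (⊤ : ℕ∞) f → DifferentiableAt ℝ f x :=
    fun hf => hf.differentiable (by simp) x
  have h := ((d hf).hasFDerivAt.mul (d hg).hasFDerivAt).sub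
    ((d hp).hasFDerivAt.mul (d hq).hasFDerivAt)
  have h' : fderiv ℝ (fun y => f y * g y - p y * q y) x = _ := h.fderiv
  simp only [partialDeriv]
  rw [h']
  simp
  ring

lemma integrable_partialDeriv_mul {h : E3 → ℝ} (hc : ∀ j, Continuous (partialDeriv j h))
    {F : E3 → ℝ} (hF : ContDiff ℝ (⊤ : ℕ∞) F) (hFs : HasCompactSupport F) (j : Fin 3) :
    Integrable fun x => partialDeriv j h x * F x :=
  ((hc j).mul hF.continuous).integrable_of_hasCompactSupport hFs.mul_left

lemma integral_partialDeriv_mul {h : E3 → ℝ} (hd : Differentiable ℝ h)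
    (hc : ∀ j, Continuous (partialDeriv j h)) {F : E3 → ℝ} (hF : ContDiff ℝ (⊤ : ℕ∞) F)
    (hFs : HasCompactSupport F) (j : Fin 3) :
    ∫ x, partialDeriv j h x * F x = -∫ x, h x * partialDeriv j F x := by
  have hF' := (contDiff_partialDeriv hF j).continuous
  have := integral_mul_fderiv_eq_neg_fderiv_mul_of_integrable (𝕜 := ℝ) (μ := (volume : Measure E3))
    (f := h) (g := F) (v := EuclideanSpace.single j 1)
    (integrable_partialDeriv_mul hc hF hFs j)
    ((hd.continuous.mul hF').integrable_of_hasCompactSupport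
      (hasCompactSupport_partialDeriv hFs j).mul_left)
    ((hd.continuous.mul hF.continuous).integrable_of_hasCompactSupport hFs.mul_left)
    (fun x _ => hd x) (fun x _ => hF.differentiable (by simp) x)
  simp only [partialDeriv]
  rw [this, neg_neg]

/-- The Jacobian determinant is a null Lagrangian. -/
lemma integral_jacobianDet {h f g : E3 → ℝ} (hd : Differentiable ℝ h)
    (hc : ∀ j, Continuous (partialDeriv j h)) (hf : ContDiff ℝ (⊤ : ℕ∞) f)
    (hfs : HasCompactSupport f) (hg : ContDiff ℝ (⊤ : ℕ∞) g) :
    Integrable (jacobianDet h f g) ∧ ∫ x, jacobianDet h f g x = 0 := by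
  set G : Fin 3 → E3 → ℝ := fun j x =>
    partialDeriv (j + 1) f x * partialDeriv (j + 2) g x -
      partialDeriv (j + 2) f x * partialDeriv (j + 1) g x with hG
  have hGc : ∀ j, ContDiff ℝ (⊤ : ℕ∞) (G j) := fun j =>
    ((contDiff_partialDeriv hf _).mul (contDiff_partialDeriv hg _)).sub
      ((contDiff_partialDeriv hf _).mul (contDiff_partialDeriv hg _))
  have hGs : ∀ j, HasCompactSupport (G j) := fun j =>
    ((hasCompactSupport_partialDeriv hfs _).mul_right).sub
      ((hasCompactSupport_partialDeriv hfs _).mul_right)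
  have hGi : ∀ j, Integrable fun x => partialDeriv j h x * G j x := fun j =>
    integrable_partialDeriv_mul hc (hGc j) (hGs j) j
  have hdiv : ∀ x, ∑ j, partialDeriv j (G j) x = 0 := by
    intro x
    have : ∀ j, partialDeriv j (G j) x = _ := fun j =>
      partialDeriv_mul_sub (contDiff_partialDeriv hf (j + 1)) (contDiff_partialDeriv hg (j + 2))
        (contDiff_partialDeriv hf (j + 2)) (contDiff_partialDeriv hg (j + 1)) j x
    simp only [this, Fin.sum_univ_three]
    norm_num [Fin.ext_iff]
    rw [show (1 + 2 : Fin 3) = 0 from rfl, show (2 + 2 : Fin 3) = 1 from rfl,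
      show (2 + 1 : Fin 3) = 0 from rfl, show (1 + 1 : Fin 3) = 2 from rfl]
    rw [partialDeriv_comm hf 1 0, partialDeriv_comm hf 2 0, partialDeriv_comm hf 2 1,
      partialDeriv_comm hg 1 0, partialDeriv_comm hg 2 0, partialDeriv_comm hg 2 1]
    ring
  have hGi' : ∀ j, Integrable fun x => h x * partialDeriv j (G j) x := fun j =>
    (hd.continuous.mul (contDiff_partialDeriv (hGc j) j).continuous).integrable_of_hasCompactSupport
      (hasCompactSupport_partialDeriv (hGs j) j).mul_left
  refine ⟨integrable_finsetSum _ fun j _ => hGi j, ?_⟩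
  calc ∫ x, jacobianDet h f g x = ∑ j, ∫ x, partialDeriv j h x * G j x :=
        integral_finsetSum _ fun j _ => hGi j
    _ = ∑ j, -∫ x, h x * partialDeriv j (G j) x :=
        Finset.sum_congr rfl fun j _ => integral_partialDeriv_mul hd hc (hGc j) (hGs j) j
    _ = -∫ x, ∑ j, h x * partialDeriv j (G j) x := by
        rw [integral_finsetSum _ fun j _ => hGi' j, Finset.sum_neg_distrib]
    _ = 0 := by simp [← Finset.mul_sum, hdiv]

lemma hasFDerivAt_norm_mul_coord (m : Fin 3) (x : E3) :
    HasFDerivAt (fun y : E3 => ‖y‖ * y m)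
      (‖x‖ • (EuclideanSpace.proj m : E3 →L[ℝ] ℝ) + (x m / ‖x‖) • innerSL ℝ x) x := by
  by_cases hx : x = 0
  · subst hx
    simp only [norm_zero, zero_smul, PiLp.zero_apply, zero_div, add_zero]
    rw [hasFDerivAt_iff_isLittleO_nhds_zero]
    have h1 : (fun y : E3 => ‖y‖ * y m) =O[nhds 0] fun y => ‖y‖ * ‖y‖ := by
      refine Asymptotics.IsBigO.of_bound 1 (Eventually.of_forall fun y => ?_)
      rw [one_mul, norm_mul, norm_mul, norm_norm]
      exact mul_le_mul_of_nonneg_left (PiLp.norm_apply_le y m) (norm_nonneg _)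
    have h2 : (fun y : E3 => ‖y‖ * ‖y‖) =o[nhds 0] fun y => y := by
      have h3 : (fun y : E3 => ‖y‖) =o[nhds 0] fun _ => (1 : ℝ) := by
        rw [Asymptotics.isLittleO_one_iff]
        exact tendsto_norm_zero
      have := h3.mul_isBigO (Asymptotics.isBigO_refl (fun y : E3 => ‖y‖) (nhds 0))
      exact Asymptotics.isLittleO_norm_right.1 (by simpa using this)
    simpa using h1.trans_isLittleO h2
  · have hn := (hasStrictFDerivAt_norm_sq x).hasFDerivAt.sqrt (by simpa using hx)
    have hm : HasFDerivAt (fun y : E3 => y m) (EuclideanSpace.proj m : E3 →L[ℝ] ℝ) x :=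
      (EuclideanSpace.proj m : E3 →L[ℝ] ℝ).hasFDerivAt
    have h := hn.mul hm
    simp only [Real.sqrt_sq (norm_nonneg _)] at h
    refine h.congr_fderiv ?_
    ext y
    simp
    field_simp

lemma partialDeriv_norm_mul_coord (j m : Fin 3) (x : E3) :
    partialDeriv j (fun y : E3 => ‖y‖ * y m) x =
      ‖x‖ * (if m = j then 1 else 0) + x m * x j / ‖x‖ := by
  rw [partialDeriv, (hasFDerivAt_norm_mul_coord m x).fderiv]
  simp [EuclideanSpace.inner_single_right]
  ring

lemma continuous_partialDeriv_norm_mul_coord (j m : Fin 3) :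
    Continuous (partialDeriv j (fun y : E3 => ‖y‖ * y m)) := by
  have h : partialDeriv j (fun y : E3 => ‖y‖ * y m) = fun x =>
      ‖x‖ * (if m = j then 1 else 0) + x m * x j / ‖x‖ :=
    funext fun x => partialDeriv_norm_mul_coord j m x
  rw [h]
  refine (by fun_prop : Continuous fun x : E3 => ‖x‖ * (if m = j then (1 : ℝ) else 0)).add ?_
  rw [continuous_iff_continuousAt]
  intro x
  by_cases hx : x = 0
  · subst hx
    unfold ContinuousAt
    have h0 : Tendsto (fun x : E3 => ‖x‖) (nhds 0) (nhds 0) := tendsto_norm_zero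
    simp only [PiLp.zero_apply, mul_zero, zero_div]
    refine squeeze_zero_norm (fun y => ?_) h0
    rw [norm_div, norm_mul, norm_norm]
    refine div_le_of_le_mul₀ (norm_nonneg _) (norm_nonneg _) ?_
    exact mul_le_mul (PiLp.norm_apply_le y m) (PiLp.norm_apply_le y j) (norm_nonneg _)
      (norm_nonneg _)
  · exact ContinuousAt.div (by fun_prop) (by fun_prop) (by simpa using hx)

/-- Pointwise bound for a two-spinor with partial derivatives `(a j + i b j, c j + i d j)`: up to a
combination of Jacobian determinants, `r |σ·∇u|²` dominates the square of the radial derivative. -/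
lemma two_spinor_lower_bound (a b c d x : Fin 3 → ℝ) {r : ℝ} (hr : 0 < r)
    (hrx : r ^ 2 = ∑ j, x j ^ 2) (J : Fin 3 → (Fin 3 → ℝ) → (Fin 3 → ℝ) → ℝ)
    (hJ : ∀ m f g, J m f g = ∑ l, (r * (if m = l then 1 else 0) + x m * x l / r) *
      (f (l + 1) * g (l + 2) - f (l + 2) * g (l + 1))) :
    ((∑ j, x j * a j) ^ 2 + (∑ j, x j * b j) ^ 2 + (∑ j, x j * c j) ^ 2 +
        (∑ j, x j * d j) ^ 2) / r +
      2 * (J 1 a c + J 1 b d - J 0 a d - J 0 c b - J 2 a b + J 2 c d) ≤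
    r * ((c 0 + d 1 + a 2) ^ 2 + (d 0 - c 1 + b 2) ^ 2 +
      ((a 0 - b 1 - c 2) ^ 2 + (b 0 + a 1 - d 2) ^ 2)) := by
  set q : (Fin 3 → ℝ) → Fin 3 → ℝ := fun f j =>
    x (j + 1) * f (j + 2) - x (j + 2) * f (j + 1) with hq
  set t : (Fin 3 → ℝ) → Fin 3 → ℝ := fun f j =>
    r ^ 2 * f j - x j * ∑ k, x k * f k with ht
  have i12 : (1 + 2 : Fin 3) = 0 := rfl
  have i22 : (2 + 2 : Fin 3) = 1 := rfl
  have i21 : (2 + 1 : Fin 3) = 0 := rfl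
  have i11 : (1 + 1 : Fin 3) = 2 := rfl
  have h01 : (0 : Fin 3) ≠ 1 := by decide
  have h02 : (0 : Fin 3) ≠ 2 := by decide
  have h12 : (1 : Fin 3) ≠ 2 := by decide
  have hJr : ∀ m f g, r * J m f g = ∑ l, (r ^ 2 * (if m = l then 1 else 0) + x m * x l) *
      (f (l + 1) * g (l + 2) - f (l + 2) * g (l + 1)) := by
    intro m f g
    rw [hJ, Finset.mul_sum]
    refine Finset.sum_congr rfl fun l _ => ?_
    field_simp
  set E : ℝ := r ^ 2 * ((c 0 + d 1 + a 2) ^ 2 + (d 0 - c 1 + b 2) ^ 2 +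
      ((a 0 - b 1 - c 2) ^ 2 + (b 0 + a 1 - d 2) ^ 2)) -
    ((∑ j, x j * a j) ^ 2 + (∑ j, x j * b j) ^ 2 + (∑ j, x j * c j) ^ 2 +
        (∑ j, x j * d j) ^ 2) -
      2 * (r * J 1 a c + r * J 1 b d - r * J 0 a d - r * J 0 c b - r * J 2 a b + r * J 2 c d)
    with hE
  have key : 2 * r ^ 2 * E = ∑ j,
      ((t a j - (x 2 * q b j + x 0 * q d j - x 1 * q c j)) ^ 2 +
        (t b j + (x 2 * q a j + x 0 * q c j + x 1 * q d j)) ^ 2 +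
        (t c j - (x 0 * q b j + x 1 * q a j - x 2 * q d j)) ^ 2 +
        (t d j + (x 0 * q a j - x 1 * q b j - x 2 * q c j)) ^ 2) := by
    simp only [hE, hJr, hq, ht, hrx, Fin.sum_univ_three, zero_add, i12, i22, i21, i11, h01, h02,
      h12, h01.symm, h02.symm, h12.symm, if_true, if_false]
    ring
  have hE0 : 0 ≤ E := by
    refine (mul_nonneg_iff_of_pos_left (by positivity : 0 < 2 * r ^ 2)).1 ?_
    rw [key]
    positivity
  rw [← sub_nonneg]
  refine (div_nonneg hE0 hr.le).trans_eq ?_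
  rw [hE]
  field_simp
  ring

section Components

variable {ψ : E3 → C4}

lemma contDiff_re (hψ : ContDiff ℝ (⊤ : ℕ∞) ψ) (i : Fin 4) :
    ContDiff ℝ (⊤ : ℕ∞) fun x => (ψ x i).re :=
  Complex.reCLM.contDiff.comp
    (((EuclideanSpace.proj i : C4 →L[ℂ] ℂ).restrictScalars ℝ).contDiff.comp hψ)

lemma contDiff_im (hψ : ContDiff ℝ (⊤ : ℕ∞) ψ) (i : Fin 4) :
    ContDiff ℝ (⊤ : ℕ∞) fun x => (ψ x i).im :=
  Complex.imCLM.contDiff.comp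
    (((EuclideanSpace.proj i : C4 →L[ℂ] ℂ).restrictScalars ℝ).contDiff.comp hψ)

lemma partialDeriv_re (hψ : ContDiff ℝ (⊤ : ℕ∞) ψ) (i : Fin 4) (j : Fin 3) (x : E3) :
    partialDeriv j (fun x => (ψ x i).re) x = (pderiv3 j ψ x i).re := by
  have h := ((Complex.reCLM.comp ((EuclideanSpace.proj i : C4 →L[ℂ] ℂ).restrictScalars
    ℝ)).hasFDerivAt).comp x (hψ.differentiable (by simp) x).hasFDerivAt
  have h' : fderiv ℝ (fun x => (ψ x i).re) x = _ := h.fderiv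
  rw [partialDeriv, h']
  rfl

lemma partialDeriv_im (hψ : ContDiff ℝ (⊤ : ℕ∞) ψ) (i : Fin 4) (j : Fin 3) (x : E3) :
    partialDeriv j (fun x => (ψ x i).im) x = (pderiv3 j ψ x i).im := by
  have h := ((Complex.imCLM.comp ((EuclideanSpace.proj i : C4 →L[ℂ] ℂ).restrictScalars
    ℝ)).hasFDerivAt).comp x (hψ.differentiable (by simp) x).hasFDerivAt
  have h' : fderiv ℝ (fun x => (ψ x i).im) x = _ := h.fderiv
  rw [partialDeriv, h']
  rfl

lemma fderiv_self_eq_sum (x : E3) : fderiv ℝ ψ x x = ∑ j, x j • pderiv3 j ψ x := by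
  have hx : x = ∑ j, x j • (EuclideanSpace.single j 1 : E3) := by
    ext k
    simp [Fin.sum_univ_three]
    fin_cases k <;> simp
  conv_lhs => rw [hx, map_sum]
  simp only [← hx, map_smul, pderiv3]

lemma norm_sq_eq_re_im (z : C4) :
    ‖z‖ ^ 2 = (z 0).re ^ 2 + (z 0).im ^ 2 + ((z 1).re ^ 2 + (z 1).im ^ 2) +
      ((z 2).re ^ 2 + (z 2).im ^ 2 + ((z 3).re ^ 2 + (z 3).im ^ 2)) := by
  rw [EuclideanSpace.norm_sq_eq, Fin.sum_univ_four]
  simp only [← Complex.normSq_eq_norm_sq, Complex.normSq_apply]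
  ring

lemma norm_sq_diracD (x : E3) (p : Fin 3 → Fin 4 → ℂ) (hp : ∀ j i, p j i = pderiv3 j ψ x i) :
    ‖diracD ψ x‖ ^ 2 =
      ((p 0 1).re + (p 1 1).im + (p 2 0).re) ^ 2 + ((p 0 1).im - (p 1 1).re + (p 2 0).im) ^ 2 +
      (((p 0 0).re - (p 1 0).im - (p 2 1).re) ^ 2 +
        ((p 0 0).im + (p 1 0).re - (p 2 1).im) ^ 2) +
      (((p 0 3).re + (p 1 3).im + (p 2 2).re) ^ 2 +
        ((p 0 3).im - (p 1 3).re + (p 2 2).im) ^ 2 +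
      (((p 0 2).re - (p 1 2).im - (p 2 3).re) ^ 2 +
        ((p 0 2).im + (p 1 2).re - (p 2 3).im) ^ 2)) := by
  have hs : ‖diracD ψ x‖ = ‖∑ j : Fin 3, mulVecE (diracAlpha j) (pderiv3 j ψ x)‖ := by
    rw [diracD, norm_smul]; simp
  have f0 : (finSumFinEquiv.symm (0 : Fin 4) : Fin 2 ⊕ Fin 2) = Sum.inl 0 := rfl
  have f1 : (finSumFinEquiv.symm (1 : Fin 4) : Fin 2 ⊕ Fin 2) = Sum.inl 1 := rfl
  have f2 : (finSumFinEquiv.symm (2 : Fin 4) : Fin 2 ⊕ Fin 2) = Sum.inr 0 := rfl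
  have f3 : (finSumFinEquiv.symm (3 : Fin 4) : Fin 2 ⊕ Fin 2) = Sum.inr 1 := rfl
  rw [hs, norm_sq_eq_re_im]
  simp [Fin.sum_univ_three, mulVecE, diracAlpha, Matrix.toLpLin_apply, Matrix.mulVec,
    dotProduct, Fin.sum_univ_four, f0, f1, f2, f3, pauli, ← hp]
  ring

end Components

/-- The combination of Jacobian determinants occurring in `two_spinor_lower_bound`. -/
def spinorJacobian (a b c d : E3 → ℝ) (x : E3) : ℝ :=
  jacobianDet (fun y => ‖y‖ * y 1) a c x + jacobianDet (fun y => ‖y‖ * y 1) b d x -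
    jacobianDet (fun y => ‖y‖ * y 0) a d x - jacobianDet (fun y => ‖y‖ * y 0) c b x -
    jacobianDet (fun y => ‖y‖ * y 2) a b x + jacobianDet (fun y => ‖y‖ * y 2) c d x

lemma integral_spinorJacobian {a b c d : E3 → ℝ} (ha : ContDiff ℝ (⊤ : ℕ∞) a)
    (has : HasCompactSupport a) (hb : ContDiff ℝ (⊤ : ℕ∞) b) (hbs : HasCompactSupport b)
    (hc : ContDiff ℝ (⊤ : ℕ∞) c) (hcs : HasCompactSupport c) (hd : ContDiff ℝ (⊤ : ℕ∞) d) :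
    Integrable (spinorJacobian a b c d) ∧ ∫ x, spinorJacobian a b c d x = 0 := by
  have hdm : ∀ m : Fin 3, Differentiable ℝ fun y : E3 => ‖y‖ * y m := fun m x =>
    (hasFDerivAt_norm_mul_coord m x).differentiableAt
  have J : ∀ (m : Fin 3) {f g : E3 → ℝ}, ContDiff ℝ (⊤ : ℕ∞) f → HasCompactSupport f →
      ContDiff ℝ (⊤ : ℕ∞) g → Integrable (jacobianDet (fun y => ‖y‖ * y m) f g) ∧
        ∫ x, jacobianDet (fun y => ‖y‖ * y m) f g x = 0 := fun m _ _ hf hfs hg =>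
    integral_jacobianDet (hdm m) (fun j => continuous_partialDeriv_norm_mul_coord j m) hf hfs hg
  obtain ⟨i1, e1⟩ := J 1 ha has hc
  obtain ⟨i2, e2⟩ := J 1 hb hbs hd
  obtain ⟨i3, e3⟩ := J 0 ha has hd
  obtain ⟨i4, e4⟩ := J 0 hc hcs hb
  obtain ⟨i5, e5⟩ := J 2 ha has hb
  obtain ⟨i6, e6⟩ := J 2 hc hcs hd
  refine ⟨((((i1.add i2).sub i3).sub i4).sub i5).add i6, ?_⟩
  have h := integral_add ((((i1.add i2).sub i3).sub i4).sub i5) i6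
  have h5 := integral_sub (((i1.add i2).sub i3).sub i4) i5
  have h4 := integral_sub ((i1.add i2).sub i3) i4
  have h3 := integral_sub (i1.add i2) i3
  have h2 := integral_add i1 i2
  simp only [Pi.add_apply, Pi.sub_apply] at h h5 h4 h3 h2
  simp only [spinorJacobian]
  rw [h, h5, h4, h3, h2, e1, e2, e3, e4, e5, e6]
  simp

lemma norm_sq_diracD_lower_bound {ψ : E3 → C4} (hψ : ContDiff ℝ (⊤ : ℕ∞) ψ) {x : E3}
    (hx : x ≠ 0) :
    ‖fderiv ℝ ψ x x‖ ^ 2 / ‖x‖ +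
      (2 * spinorJacobian (fun y => (ψ y 0).re) (fun y => (ψ y 0).im) (fun y => (ψ y 1).re)
        (fun y => (ψ y 1).im) x +
      2 * spinorJacobian (fun y => (ψ y 2).re) (fun y => (ψ y 2).im) (fun y => (ψ y 3).re)
        (fun y => (ψ y 3).im) x) ≤ ‖x‖ * ‖diracD ψ x‖ ^ 2 := by
  have hr : 0 < ‖x‖ := norm_pos_iff.2 hx
  have hrx : ‖x‖ ^ 2 = ∑ j, x j ^ 2 := by
    rw [EuclideanSpace.norm_sq_eq]
    simp
  obtain ⟨p, hp⟩ : ∃ p : Fin 3 → Fin 4 → ℂ, ∀ j i, p j i = pderiv3 j ψ x i := ⟨_, fun _ _ => rfl⟩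
  set J : Fin 3 → (Fin 3 → ℝ) → (Fin 3 → ℝ) → ℝ := fun m f g =>
    ∑ l, (‖x‖ * (if m = l then 1 else 0) + x m * x l / ‖x‖) *
      (f (l + 1) * g (l + 2) - f (l + 2) * g (l + 1)) with hJ
  have hdet : ∀ m f g, jacobianDet (fun y => ‖y‖ * y m) f g x =
      J m (fun j => partialDeriv j f x) (fun j => partialDeriv j g x) := by
    intro m f g
    simp only [jacobianDet, partialDeriv_norm_mul_coord, hJ]
  have B := fun i k : Fin 4 => two_spinor_lower_bound (fun j => (p j i).re) (fun j => (p j i).im)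
    (fun j => (p j k).re) (fun j => (p j k).im) x hr hrx J fun _ _ _ => rfl
  have hrad : ∀ i, (fderiv ℝ ψ x x i).re = ∑ j, x j * (p j i).re ∧
      (fderiv ℝ ψ x x i).im = ∑ j, x j * (p j i).im := by
    intro i
    rw [fderiv_self_eq_sum]
    simp [hp]
  rw [norm_sq_diracD x p hp, norm_sq_eq_re_im]
  simp only [spinorJacobian, hdet, partialDeriv_re hψ, partialDeriv_im hψ, ← hp, hrad]
  exact (le_of_eq (by ring)).trans ((add_le_add (B 0 1) (B 2 3)).trans_eq (by ring))

/-- Integration in polar coordinates in `ℝ³`. -/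
lemma lintegral_eq_lintegral_sphere_Ioi {f : E3 → ENNReal} (hf : Measurable f) :
    ∫⁻ x, f x = ∫⁻ ω, (∫⁻ r in Set.Ioi (0 : ℝ), ENNReal.ofReal (r ^ 2) * f (r • (ω : E3)))
      ∂(volume : Measure E3).toSphere := by
  have hmp := (volume : Measure E3).measurePreserving_homeomorphUnitSphereProd
  have hdim : Module.finrank ℝ E3 - 1 = 2 := by simp
  rw [hdim] at hmp
  have hg : Measurable fun p : Metric.sphere (0 : E3) 1 × Set.Ioi (0 : ℝ) =>
      f ((p.2 : ℝ) • (p.1 : E3)) := by fun_prop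
  calc ∫⁻ x, f x = ∫⁻ x in ({0}ᶜ : Set E3), f x := by
        rw [restrict_compl_singleton]
    _ = ∫⁻ x : ({0}ᶜ : Set E3), f x ∂(Measure.comap Subtype.val volume) :=
        (lintegral_subtype_comap (measurableSet_singleton _).compl f).symm
    _ = ∫⁻ x : ({0}ᶜ : Set E3), (fun p : Metric.sphere (0 : E3) 1 × Set.Ioi (0 : ℝ) =>
          f ((p.2 : ℝ) • (p.1 : E3))) (homeomorphUnitSphereProd E3 x)
          ∂(Measure.comap Subtype.val volume) := by
        refine lintegral_congr fun x => ?_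
        have hx : ‖(x : E3)‖ ≠ 0 := norm_ne_zero_iff.2 x.2
        simp [smul_smul, hx]
    _ = ∫⁻ p, f ((p.2 : ℝ) • (p.1 : E3))
          ∂((volume : Measure E3).toSphere.prod (Measure.volumeIoiPow 2)) :=
        hmp.lintegral_comp hg
    _ = ∫⁻ ω, ∫⁻ r, f ((r : ℝ) • (ω : E3)) ∂(Measure.volumeIoiPow 2)
          ∂(volume : Measure E3).toSphere := lintegral_prod _ hg.aemeasurable
    _ = _ := by
        refine lintegral_congr fun ω => ?_
        rw [Measure.volumeIoiPow, lintegral_withDensity_eq_lintegral_mul _ (by fun_prop)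
          (by fun_prop)]
        exact lintegral_subtype_comap measurableSet_Ioi
          (fun r : ℝ => ENNReal.ofReal (r ^ 2) * f (r • (ω : E3)))

section Radial

variable {ψ : E3 → C4}

lemma measurable_log_remainder (hψ : Continuous ψ) (R : ℝ) :
    Measurable fun x : E3 => ‖ψ x - (R / ‖x‖) • ψ ((R / ‖x‖) • x)‖ ^ 2 /
      (‖x‖ * Real.log (‖x‖ / R) ^ 2) := by
  have hm := hψ.measurable
  have : Measurable fun x : E3 => ψ ((R / ‖x‖) • x) := hm.comp (by fun_prop)
  fun_prop

lemma lintegral_hardy_log (hψ : ContDiff ℝ (⊤ : ℕ∞) ψ) (hsupp : HasCompactSupport ψ) {R : ℝ}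
    (hR : 0 < R) :
    ∫⁻ x : E3, ENNReal.ofReal (‖ψ x‖ ^ 2 / ‖x‖ +
      1 / 4 * (‖ψ x - (R / ‖x‖) • ψ ((R / ‖x‖) • x)‖ ^ 2 /
        (‖x‖ * Real.log (‖x‖ / R) ^ 2))) ≤
    ∫⁻ x : E3, ENNReal.ofReal (‖fderiv ℝ ψ x x‖ ^ 2 / ‖x‖) := by
  have hψc := hψ.continuous
  have hm := hψc.measurable
  have hfc : Continuous (fderiv ℝ ψ) := hψ.continuous_fderiv (by simp)
  obtain ⟨b, hb⟩ := hsupp.isCompact.isBounded.exists_norm_le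
  have hmW := measurable_log_remainder hψc R
  have hmP : Measurable fun x : E3 => ‖fderiv ℝ ψ x x‖ ^ 2 :=
    (by fun_prop : Continuous fun x : E3 => ‖fderiv ℝ ψ x x‖ ^ 2).measurable
  rw [lintegral_eq_lintegral_sphere_Ioi (by fun_prop),
    lintegral_eq_lintegral_sphere_Ioi (by fun_prop)]
  refine lintegral_mono fun ω => ?_
  have hω : ‖(ω : E3)‖ = 1 := by simp
  have hv : ∀ r : ℝ, HasDerivAt (fun r : ℝ => ψ (r • (ω : E3)))
      (fderiv ℝ ψ (r • (ω : E3)) (ω : E3)) r := by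
    intro r
    have h1 : HasDerivAt (fun r : ℝ => r • (ω : E3)) ((1 : ℝ) • (ω : E3)) r :=
      (hasDerivAt_id r).smul_const _
    rw [one_smul] at h1
    exact (hψ.differentiable (by simp) _).hasFDerivAt.comp_hasDerivAt r h1
  have hv0 : ∀ r : ℝ, max (b + 1) 0 ≤ r → ψ (r • (ω : E3)) = 0 := by
    intro r hr
    by_contra h
    have := hb _ (subset_tsupport ψ h)
    rw [norm_smul, hω, mul_one, Real.norm_eq_abs, abs_of_nonneg ((le_max_right _ _).trans hr)]
      at this
    linarith [(le_max_left (b + 1) 0).trans hr]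
  have h1d := hardy_log_Ioi hv (by fun_prop) hR hv0
  refine (lintegral_mono_ae ?_).trans (h1d.trans (lintegral_mono_ae ?_))
  · filter_upwards [ae_restrict_mem measurableSet_Ioi] with r hr
    have hr0 : 0 < r := hr
    rw [← ENNReal.ofReal_mul (by positivity), norm_smul, hω, mul_one, Real.norm_eq_abs,
      abs_of_pos hr0, smul_smul, div_mul_cancel₀ _ hr0.ne']
    have : r • ψ (r • (ω : E3)) - R • ψ (R • (ω : E3)) =
        r • (ψ (r • (ω : E3)) - (R / r) • ψ (R • (ω : E3))) := by
      rw [smul_sub, smul_smul, mul_div_cancel₀ _ hr0.ne']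
    rw [this, norm_smul, Real.norm_eq_abs, abs_of_pos hr0]
    refine (congrArg ENNReal.ofReal ?_).le
    field_simp
  · filter_upwards [ae_restrict_mem measurableSet_Ioi] with r hr
    have hr0 : 0 < r := hr
    rw [← ENNReal.ofReal_mul (by positivity), norm_smul, hω, mul_one, map_smul, norm_smul,
      Real.norm_eq_abs, abs_of_pos hr0]
    refine (congrArg ENNReal.ofReal ?_).le
    field_simp

lemma integrable_norm_fderiv_self (hψ : ContDiff ℝ (⊤ : ℕ∞) ψ) (hsupp : HasCompactSupport ψ) :
    Integrable fun x : E3 => ‖fderiv ℝ ψ x x‖ ^ 2 / ‖x‖ := by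
  have hfc : Continuous (fderiv ℝ ψ) := hψ.continuous_fderiv (by simp)
  have hmP : Measurable fun x : E3 => ‖fderiv ℝ ψ x x‖ ^ 2 :=
    (by fun_prop : Continuous fun x : E3 => ‖fderiv ℝ ψ x x‖ ^ 2).measurable
  have hs : HasCompactSupport fun x : E3 => ‖fderiv ℝ ψ x‖ ^ 2 * ‖x‖ :=
    (hsupp.fderiv (𝕜 := ℝ)).comp_left (g := fun A => ‖A‖ ^ 2) (by simp) |>.mul_right
  have hi : Integrable fun x : E3 => ‖fderiv ℝ ψ x‖ ^ 2 * ‖x‖ :=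
    (by fun_prop : Continuous fun x : E3 => ‖fderiv ℝ ψ x‖ ^ 2 * ‖x‖).integrable_of_hasCompactSupport
      hs
  refine hi.mono' (hmP.div measurable_norm).aestronglyMeasurable (Eventually.of_forall fun x => ?_)
  rw [Real.norm_of_nonneg (by positivity)]
  refine div_le_of_le_mul₀ (norm_nonneg _) (by positivity) ?_
  calc ‖fderiv ℝ ψ x x‖ ^ 2 ≤ (‖fderiv ℝ ψ x‖ * ‖x‖) ^ 2 :=
        pow_le_pow_left₀ (norm_nonneg _) ((fderiv ℝ ψ x).le_opNorm x) 2
    _ = _ := by ring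

lemma integrable_norm_mul_diracD (hψ : ContDiff ℝ (⊤ : ℕ∞) ψ) (hsupp : HasCompactSupport ψ) :
    Integrable fun x : E3 => ‖x‖ * ‖diracD ψ x‖ ^ 2 := by
  have hfc : Continuous (fderiv ℝ ψ) := hψ.continuous_fderiv (by simp)
  have hM : ∀ M, Continuous (mulVecE M) := fun M =>
    LinearMap.continuous_of_finiteDimensional (Matrix.toEuclideanLin M)
  have hD : Continuous (diracD ψ) := by
    have : ∀ j, Continuous fun x => mulVecE (diracAlpha j) (pderiv3 j ψ x) := fun j =>
      (hM _).comp (hfc.clm_apply continuous_const)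
    have hsum : Continuous fun x => ∑ j : Fin 3, mulVecE (diracAlpha j) (pderiv3 j ψ x) :=
      continuous_finsetSum _ fun j _ => this j
    exact hsum.const_smul (-Complex.I)
  have hs : HasCompactSupport (diracD ψ) := by
    refine (hsupp.fderiv (𝕜 := ℝ)).mono' ((Function.support_subset_iff'.2 fun x hx => ?_).trans
      (subset_tsupport _))
    rw [Function.notMem_support] at hx
    simp [diracD, pderiv3, hx, mulVecE]
  have hs' : HasCompactSupport fun x : E3 => ‖x‖ * ‖diracD ψ x‖ ^ 2 :=
    (hs.comp_left (g := fun z => ‖z‖ ^ 2) (by simp)).mul_left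
  exact (by fun_prop : Continuous fun x : E3 => ‖x‖ * ‖diracD ψ x‖ ^ 2).integrable_of_hasCompactSupport
    hs'

/-- The weighted Dirac energy dominates the weighted energy of the radial derivative. -/
lemma integral_radial_le_integral_diracD (hψ : ContDiff ℝ (⊤ : ℕ∞) ψ)
    (hsupp : HasCompactSupport ψ) :
    ∫ x : E3, ‖fderiv ℝ ψ x x‖ ^ 2 / ‖x‖ ≤ ∫ x : E3, ‖x‖ * ‖diracD ψ x‖ ^ 2 := by
  have hre : ∀ i, HasCompactSupport fun x => (ψ x i).re := fun i =>
    hsupp.comp_left (g := fun z : C4 => (z i).re) (by simp)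
  have him : ∀ i, HasCompactSupport fun x => (ψ x i).im := fun i =>
    hsupp.comp_left (g := fun z : C4 => (z i).im) (by simp)
  have hN : ∀ i k, _ := fun i k => integral_spinorJacobian (contDiff_re hψ i) (hre i)
    (contDiff_im hψ i) (him i) (contDiff_re hψ k) (hre k) (contDiff_im hψ k)
  have hP := integrable_norm_fderiv_self hψ hsupp
  have hJ := ((hN 0 1).1.const_mul 2).add ((hN 2 3).1.const_mul 2)
  have hne : ∀ᵐ x : E3, x ≠ 0 := by simp [ae_iff]
  have hmono := integral_mono_ae (hP.add hJ) (integrable_norm_mul_diracD hψ hsupp)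
    (hne.mono fun x hx => norm_sq_diracD_lower_bound hψ hx)
  rw [integral_add' hP hJ, integral_add' ((hN 0 1).1.const_mul 2) ((hN 2 3).1.const_mul 2),
    integral_const_mul, integral_const_mul, (hN 0 1).2, (hN 2 3).2] at hmono
  simpa using hmono

end Radial

lemma norm_mul_norm_mulVecE_sq_le {M : Matrix (Fin 4) (Fin 4) ℂ} {t : ℝ} (ht : 0 ≤ t)
    (hM : t * ‖Matrix.toEuclideanCLM (𝕜 := ℂ) M‖ ≤ 1) (v : C4) :
    t * ‖mulVecE M v‖ ^ 2 ≤ ‖v‖ ^ 2 / t := by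
  rcases ht.eq_or_lt with rfl | ht
  · simp
  rw [le_div_iff₀ ht]
  have h1 : ‖mulVecE M v‖ ≤ ‖Matrix.toEuclideanCLM (𝕜 := ℂ) M‖ * ‖v‖ :=
    (Matrix.toEuclideanCLM (𝕜 := ℂ) M).le_opNorm v
  have h2 : t * ‖mulVecE M v‖ ≤ ‖v‖ := by
    calc t * ‖mulVecE M v‖ ≤ t * (‖Matrix.toEuclideanCLM (𝕜 := ℂ) M‖ * ‖v‖) :=
          mul_le_mul_of_nonneg_left h1 ht.le
      _ = t * ‖Matrix.toEuclideanCLM (𝕜 := ℂ) M‖ * ‖v‖ := by ring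
      _ ≤ 1 * ‖v‖ := mul_le_mul_of_nonneg_right hM (norm_nonneg v)
      _ = ‖v‖ := one_mul _
  calc t * ‖mulVecE M v‖ ^ 2 * t = (t * ‖mulVecE M v‖) ^ 2 := by ring
    _ ≤ ‖v‖ ^ 2 := pow_le_pow_left₀ (by positivity) h2 2

/-- logarithmic lower bound for the quadratic form with a critical potential. -/
theorem quadratic_form_log_lower_bound (V : E3 → Matrix (Fin 4) (Fin 4) ℂ)
    (hVmeas : ∀ i j, Measurable fun x => V x i j)
    (hV : ∀ᵐ x : E3, (V x).IsHermitian ∧ ‖x‖ * ‖Matrix.toEuclideanCLM (𝕜 := ℂ) (V x)‖ ≤ 1)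
    (ψ : E3 → C4) (hsmooth : ContDiff ℝ (⊤ : ℕ∞) ψ) (hsupp : HasCompactSupport ψ)
    (R : ℝ) (hR : 0 < R) :
    (∫ x : E3, ‖x‖ * ‖diracD ψ x‖ ^ 2) - (∫ x : E3, ‖x‖ * ‖mulVecE (V x) (ψ x)‖ ^ 2) ≥
      (1 / 4) * ∫ x : E3, ‖ψ x - (R / ‖x‖) • ψ ((R / ‖x‖) • x)‖ ^ 2 /
        (‖x‖ * (Real.log (‖x‖ / R)) ^ 2) := by
  set W : E3 → ℝ := fun x => ‖ψ x - (R / ‖x‖) • ψ ((R / ‖x‖) • x)‖ ^ 2 /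
    (‖x‖ * (Real.log (‖x‖ / R)) ^ 2) with hW
  have hWm : Measurable W := measurable_log_remainder hsmooth.continuous R
  have hBm : Measurable fun x : E3 => ‖ψ x‖ ^ 2 / ‖x‖ := by
    have := hsmooth.continuous.measurable
    fun_prop
  have hW0 : ∀ x, 0 ≤ W x := fun x => by positivity
  have hB0 : ∀ x : E3, 0 ≤ ‖ψ x‖ ^ 2 / ‖x‖ := fun x => by positivity
  have hP := integrable_norm_fderiv_self hsmooth hsupp
  have hP0 : ∀ x : E3, 0 ≤ ‖fderiv ℝ ψ x x‖ ^ 2 / ‖x‖ := fun x => by positivity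
  have hS0 : ∀ x : E3, 0 ≤ ‖ψ x‖ ^ 2 / ‖x‖ + 1 / 4 * W x := fun x =>
    add_nonneg (hB0 x) (mul_nonneg (by norm_num) (hW0 x))
  have hSm : Measurable fun x : E3 => ‖ψ x‖ ^ 2 / ‖x‖ + 1 / 4 * W x := by fun_prop
  have hlin : ∫⁻ x : E3, ENNReal.ofReal (‖ψ x‖ ^ 2 / ‖x‖ + 1 / 4 * W x) ≤
      ENNReal.ofReal (∫ x : E3, ‖fderiv ℝ ψ x x‖ ^ 2 / ‖x‖) := by
    rw [ofReal_integral_eq_lintegral_ofReal hP (Eventually.of_forall hP0)]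
    exact lintegral_hardy_log hsmooth hsupp hR
  have hS : Integrable fun x : E3 => ‖ψ x‖ ^ 2 / ‖x‖ + 1 / 4 * W x :=
    (lintegral_ofReal_ne_top_iff_integrable hSm.aestronglyMeasurable
      (Eventually.of_forall hS0)).1 (hlin.trans_lt ENNReal.ofReal_lt_top).ne
  have hB : Integrable fun x : E3 => ‖ψ x‖ ^ 2 / ‖x‖ :=
    hS.mono' hBm.aestronglyMeasurable (Eventually.of_forall fun x => by
      rw [Real.norm_of_nonneg (hB0 x)]
      linarith [hW0 x])
  have hWi : Integrable fun x : E3 => 1 / 4 * W x :=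
    hS.mono' (by fun_prop) (Eventually.of_forall fun x => by
      rw [Real.norm_of_nonneg (mul_nonneg (by norm_num) (hW0 x))]
      linarith [hB0 x])
  have hSP : ∫ x : E3, (‖ψ x‖ ^ 2 / ‖x‖ + 1 / 4 * W x) ≤
      ∫ x : E3, ‖fderiv ℝ ψ x x‖ ^ 2 / ‖x‖ := by
    rw [← ofReal_integral_eq_lintegral_ofReal hS (Eventually.of_forall hS0)] at hlin
    exact (ENNReal.ofReal_le_ofReal_iff (integral_nonneg hP0)).1 hlin
  rw [integral_add hB hWi, integral_const_mul] at hSP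
  have hVB : ∫ x : E3, ‖x‖ * ‖mulVecE (V x) (ψ x)‖ ^ 2 ≤ ∫ x : E3, ‖ψ x‖ ^ 2 / ‖x‖ :=
    integral_mono_of_nonneg (Eventually.of_forall fun x => by positivity) hB
      (hV.mono fun x hx => norm_mul_norm_mulVecE_sq_le (norm_nonneg x) hx.2 (ψ x))
  linarith [integral_radial_le_integral_diracD hsmooth hsupp]
end
end

section
/- Let 0 ≤ v < 1 and let V : ℝ³∖{0} → ℂ^{4×4} be measurable with V(x) Hermitian and |x| ‖V(x)‖ ≤ v for a.e. x ∈ ℝ³. Then for every ψ ∈ C_c^∞(ℝ³;ℂ⁴): ∫_{ℝ³} |x| |(−iα·∇ψ)(x)|² dx − ∫_{ℝ³} |x| |V(x)ψ(x)|² dx ≥ (1 − v²) ∫_{ℝ³} |ψ(x)|²/|x| dx. -/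
open MeasureTheory Real Filter

noncomputable section

variable {E : Type*} [NormedAddCommGroup E] [InnerProductSpace ℝ E]

theorem integral_mul_fderiv_of_compact {w g : E3 → ℝ} (hw : ContDiff ℝ 1 w) (hg : ContDiff ℝ 1 g)
    (hgc : HasCompactSupport g) (v : E3) :
    ∫ x, w x * fderiv ℝ g x v = -∫ x, fderiv ℝ w x v * g x := by
  have hw' : Continuous fun x => fderiv ℝ w x v :=
    (hw.continuous_fderiv one_ne_zero).clm_apply continuous_const
  have hg' : Continuous fun x => fderiv ℝ g x v :=
    (hg.continuous_fderiv one_ne_zero).clm_apply continuous_const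
  refine integral_mul_fderiv_eq_neg_fderiv_mul_of_integrable ?_ ?_ ?_
    (fun x _ => hw.differentiable one_ne_zero x) (fun x _ => hg.differentiable one_ne_zero x)
  · exact (hw'.mul hg.continuous).integrable_of_hasCompactSupport hgc.mul_left
  · exact (hw.continuous.mul hg').integrable_of_hasCompactSupport
      (hgc.fderiv_apply (𝕜 := ℝ) v).mul_left
  · exact (hw.continuous.mul hg.continuous).integrable_of_hasCompactSupport hgc.mul_left

theorem inner_fderiv_antisymm {ψ : E3 → E} (hψ : ContDiff ℝ 2 ψ) (S : E →L[ℝ] E)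
    (hS : ∀ u v, inner ℝ u (S v) = -inner ℝ v (S u)) (a b x : E3) :
    2 * inner ℝ (fderiv ℝ ψ x a) (S (fderiv ℝ ψ x b)) =
      fderiv ℝ (fun y => inner ℝ (ψ y) (S (fderiv ℝ ψ y b))) x a -
      fderiv ℝ (fun y => inner ℝ (ψ y) (S (fderiv ℝ ψ y a))) x b := by
  have h1 : DifferentiableAt ℝ ψ x := (hψ.differentiable two_ne_zero) x
  have h2 : DifferentiableAt ℝ (fderiv ℝ ψ) x :=
    ((hψ.fderiv_right (m := 1) le_rfl).differentiable one_ne_zero) x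
  have h3 : ∀ c : E3, HasFDerivAt (fun y => S (fderiv ℝ ψ y c))
      (S ∘L (fderiv ℝ (fderiv ℝ ψ) x).flip c) x := fun c =>
    S.hasFDerivAt.comp x (by simpa using h2.hasFDerivAt.clm_apply (hasFDerivAt_const c x))
  have hsymm : fderiv ℝ (fderiv ℝ ψ) x a b = fderiv ℝ (fderiv ℝ ψ) x b a :=
    (hψ.contDiffAt.isSymmSndFDerivAt (by simp)).eq a b
  rw [(h1.hasFDerivAt.inner ℝ (h3 b)).fderiv, (h1.hasFDerivAt.inner ℝ (h3 a)).fderiv]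
  simp [fderivInnerCLM_apply, hsymm]
  rw [hS (fderiv ℝ ψ x b)]
  ring

theorem integrable_mul_inner_fderiv {ψ : E3 → E} (hψ : ContDiff ℝ 1 ψ)
    (hc : HasCompactSupport ψ) {W : E3 → ℝ} (hW : Continuous W) (S : E →L[ℝ] E) (a b : E3) :
    Integrable fun x => W x * inner ℝ (fderiv ℝ ψ x a) (S (fderiv ℝ ψ x b)) := by
  have hp : ∀ v, Continuous fun x => fderiv ℝ ψ x v := fun v =>
    (hψ.continuous_fderiv one_ne_zero).clm_apply continuous_const
  refine Continuous.integrable_of_hasCompactSupport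
    (hW.mul ((hp a).inner (S.continuous.comp (hp b)))) ?_
  exact (hc.fderiv_apply (𝕜 := ℝ) a).mono fun x hx h0 =>
    hx (by simp only [h0, inner_zero_left, mul_zero])

theorem integrable_fderiv_mul_inner {ψ : E3 → E} (hψ : ContDiff ℝ 1 ψ)
    (hc : HasCompactSupport ψ) {W : E3 → ℝ} (hW : ContDiff ℝ 1 W) (S : E →L[ℝ] E) (a b : E3) :
    Integrable fun x => fderiv ℝ W x a * inner ℝ (ψ x) (S (fderiv ℝ ψ x b)) := by
  have hp : ∀ v, Continuous fun x => fderiv ℝ ψ x v := fun v =>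
    (hψ.continuous_fderiv one_ne_zero).clm_apply continuous_const
  refine Continuous.integrable_of_hasCompactSupport
    (((hW.continuous_fderiv one_ne_zero).clm_apply continuous_const).mul
      (hψ.continuous.inner (S.continuous.comp (hp b)))) ?_
  exact hc.mono fun x hx h0 => hx (by simp only [h0, inner_zero_left, mul_zero])

theorem integral_mul_inner_fderiv_antisymm {ψ : E3 → E} (hψ : ContDiff ℝ 2 ψ)
    (hc : HasCompactSupport ψ) {W : E3 → ℝ} (hW : ContDiff ℝ 1 W) (S : E →L[ℝ] E)
    (hS : ∀ u v, inner ℝ u (S v) = -inner ℝ v (S u)) (a b : E3) :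
    ∫ x, W x * inner ℝ (fderiv ℝ ψ x a) (S (fderiv ℝ ψ x b)) =
      ∫ x, 2⁻¹ * (fderiv ℝ W x b * inner ℝ (ψ x) (S (fderiv ℝ ψ x a)) -
        fderiv ℝ W x a * inner ℝ (ψ x) (S (fderiv ℝ ψ x b))) := by
  have hψ1 : ContDiff ℝ 1 ψ := hψ.of_le one_le_two
  have hg : ∀ c : E3, ContDiff ℝ 1 fun y => inner ℝ (ψ y) (S (fderiv ℝ ψ y c)) := fun c =>
    hψ1.inner ℝ (S.contDiff.comp ((hψ.fderiv_right (m := 1) le_rfl).clm_apply contDiff_const))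
  have hgc : ∀ c : E3, HasCompactSupport fun y => inner ℝ (ψ y) (S (fderiv ℝ ψ y c)) := fun c =>
    hc.mono fun x hx h0 => hx (by simp only [h0, inner_zero_left])
  have hi : ∀ c d : E3, Integrable fun x =>
      W x * fderiv ℝ (fun y => inner ℝ (ψ y) (S (fderiv ℝ ψ y c))) x d := fun c d =>
    (hW.continuous.mul (((hg c).continuous_fderiv one_ne_zero).clm_apply
      continuous_const)).integrable_of_hasCompactSupport
        ((hgc c).fderiv_apply (𝕜 := ℝ) d).mul_left
  rw [integral_const_mul, integral_sub (integrable_fderiv_mul_inner hψ1 hc hW S b a)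
    (integrable_fderiv_mul_inner hψ1 hc hW S a b)]
  have h1 := integral_mul_fderiv_of_compact hW (hg b) (hgc b) a
  have h2 := integral_mul_fderiv_of_compact hW (hg a) (hgc a) b
  have h3 : ∫ x, W x * inner ℝ (fderiv ℝ ψ x a) (S (fderiv ℝ ψ x b)) =
      ∫ x, 2⁻¹ * (W x * fderiv ℝ (fun y => inner ℝ (ψ y) (S (fderiv ℝ ψ y b))) x a -
        W x * fderiv ℝ (fun y => inner ℝ (ψ y) (S (fderiv ℝ ψ y a))) x b) := by
    congr 1 with x
    linear_combination (W x / 2) * inner_fderiv_antisymm hψ S hS a b x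
  rw [h3, integral_const_mul, integral_sub (hi b a) (hi a b)]
  linear_combination (1 / 2) * h1 - (1 / 2) * h2

/-- The regularization `(|x|² + ε²)^(-1/2)` of `1 / |x|`. -/
def regInv (ε : ℝ) (x : E3) : ℝ := (√(‖x‖ ^ 2 + ε ^ 2))⁻¹

section regInv

variable {ε : ℝ}

theorem regInv_pos (hε : 0 < ε) (x : E3) : 0 < regInv ε x := by
  unfold regInv
  positivity

theorem regInv_sq_mul (hε : 0 < ε) (x : E3) : regInv ε x ^ 2 * (‖x‖ ^ 2 + ε ^ 2) = 1 := by
  have h : 0 < ‖x‖ ^ 2 + ε ^ 2 := by positivity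
  rw [regInv, inv_pow, Real.sq_sqrt h.le, inv_mul_cancel₀ h.ne']

theorem contDiff_regInv (hε : 0 < ε) : ContDiff ℝ 1 (regInv ε) := by
  have h : ∀ x : E3, ‖x‖ ^ 2 + ε ^ 2 ≠ 0 := fun x => by positivity
  refine ((contDiff_norm_sq ℝ).add contDiff_const |>.sqrt h).inv fun x => ?_
  exact Real.sqrt_ne_zero'.2 (by positivity)

theorem fderiv_regInv (hε : 0 < ε) (x v : E3) :
    fderiv ℝ (regInv ε) x v = -regInv ε x ^ 3 * inner ℝ x v := by
  have h : 0 < ‖x‖ ^ 2 + ε ^ 2 := by positivity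
  have h1 := (hasDerivAt_inv (Real.sqrt_ne_zero'.2 h)).comp_hasFDerivAt x
    (((hasStrictFDerivAt_norm_sq x).hasFDerivAt.add_const (ε ^ 2)).sqrt h.ne')
  have h2 : fderiv ℝ (regInv ε) x = _ := h1.fderiv
  rw [h2]
  have hs := Real.sq_sqrt h.le
  have h0 : √(‖x‖ ^ 2 + ε ^ 2) ≠ 0 := Real.sqrt_ne_zero'.2 h
  simp [regInv]
  field_simp

/-- The tensor `w δⱼₗ - f xⱼ xₗ` with `f = regInv ε` and `w = (|x|² + ε²/2) f`, for which the
integral of `Re ⟪∂ₗψ, (αⱼ αₖ - δⱼₖ) ∂ₖψ⟫` vanishes. -/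
def weight (ε : ℝ) (j l : Fin 3) (x : E3) : ℝ :=
  ((‖x‖ ^ 2 + ε ^ 2 / 2) * (1 : Matrix (Fin 3) (Fin 3) ℝ) j l - x j * x l) * regInv ε x

theorem contDiff_weight (hε : 0 < ε) (j l : Fin 3) : ContDiff ℝ 1 (weight ε j l) := by
  have h : ∀ i : Fin 3, ContDiff ℝ 1 fun x : E3 => x i := fun i =>
    (EuclideanSpace.proj (𝕜 := ℝ) i).contDiff
  exact (((((contDiff_norm_sq ℝ).add contDiff_const).mul contDiff_const).sub
    ((h j).mul (h l))).mul (contDiff_regInv hε))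

theorem fderiv_weight (hε : 0 < ε) (j l c : Fin 3) (x : E3) :
    fderiv ℝ (weight ε j l) x (EuclideanSpace.single c 1) =
      (2 * x c * (1 : Matrix (Fin 3) (Fin 3) ℝ) j l -
        ((1 : Matrix (Fin 3) (Fin 3) ℝ) j c * x l + x j * (1 : Matrix (Fin 3) (Fin 3) ℝ) l c)) *
          regInv ε x -
      ((‖x‖ ^ 2 + ε ^ 2 / 2) * (1 : Matrix (Fin 3) (Fin 3) ℝ) j l - x j * x l) *
        (regInv ε x ^ 3 * x c) := by
  have h : ∀ i : Fin 3, HasFDerivAt (fun x : E3 => x i) (EuclideanSpace.proj (𝕜 := ℝ) i) x :=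
    fun i => (EuclideanSpace.proj (𝕜 := ℝ) i).hasFDerivAt
  have h1 := ((((hasStrictFDerivAt_norm_sq x).hasFDerivAt.add_const (ε ^ 2 / 2)).mul_const
    ((1 : Matrix (Fin 3) (Fin 3) ℝ) j l)).sub ((h j).mul (h l))).mul
      ((contDiff_regInv hε).differentiable one_ne_zero x).hasFDerivAt
  have h2 : fderiv ℝ (weight ε j l) x = _ := h1.fderiv
  rw [h2]
  clear h1 h2
  generalize (1 : Matrix (Fin 3) (Fin 3) ℝ) j l = d
  simp [fderiv_regInv hε, EuclideanSpace.inner_single_right, Matrix.one_apply]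
  ring

end regInv

theorem sum_fderiv_weight_eq_zero {ε : ℝ} (hε : 0 < ε) (x : E3) (s : Fin 3 → Fin 3 → ℝ) :
    ∑ i : Fin 3, ∑ l : Fin 3,
      ((fderiv ℝ (weight ε i l) x (EuclideanSpace.single (i + 1) 1) * s i l -
          fderiv ℝ (weight ε i l) x (EuclideanSpace.single l 1) * s i (i + 1)) -
        (fderiv ℝ (weight ε (i + 1) l) x (EuclideanSpace.single i 1) * s i l -
          fderiv ℝ (weight ε (i + 1) l) x (EuclideanSpace.single l 1) * s i i)) = 0 := by
  have h1 := regInv_sq_mul hε x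
  have h2 : ‖x‖ ^ 2 = x 0 ^ 2 + x 1 ^ 2 + x 2 ^ 2 := by
    simp [EuclideanSpace.norm_sq_eq, Fin.sum_univ_three]
  have e1 : (0 : Fin 3) + 1 = 1 := rfl
  have e2 : (1 : Fin 3) + 1 = 2 := rfl
  have e3 : (2 : Fin 3) + 1 = 0 := rfl
  simp only [fderiv_weight hε, Fin.sum_univ_three, e1, e2, e3]
  simp only [h2] at h1 ⊢
  simp [Matrix.one_apply]
  linear_combination (x 0 * s 0 1 - x 1 * s 0 0 + x 1 * s 1 2 - x 2 * s 1 1 + x 2 * s 2 0 -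
    x 0 * s 2 2) * regInv ε x * h1

theorem integral_sum_sum_congr {ι κ : Type*} [Fintype ι] [Fintype κ] {F G : ι → κ → E3 → ℝ}
    (hF : ∀ i l, Integrable (F i l)) (hG : ∀ i l, Integrable (G i l))
    (h : ∀ i l, ∫ x, F i l x = ∫ x, G i l x) :
    ∫ x, ∑ i, ∑ l, F i l x = ∫ x, ∑ i, ∑ l, G i l x := by
  rw [integral_finsetSum _ fun i _ => integrable_finsetSum _ fun l _ => hF i l,
    integral_finsetSum _ fun i _ => integrable_finsetSum _ fun l _ => hG i l]
  simp_rw [fun i => integral_finsetSum Finset.univ fun l _ => hF i l,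
    fun i => integral_finsetSum Finset.univ fun l _ => hG i l, h]

section Dirac

variable {A : Fin 3 → E →L[ℝ] E}

/-- Symmetric operators satisfying the Clifford relations. -/
structure IsClifford (A : Fin 3 → E →L[ℝ] E) : Prop where
  symm : ∀ j u v, inner ℝ (A j u) v = inner ℝ u (A j v)
  sq : ∀ j u, A j (A j u) = u
  anti : ∀ j k, j ≠ k → ∀ u, A j (A k u) = -A k (A j u)

theorem IsClifford.integral_eq_zero (hA : IsClifford A) {ψ : E3 → E} (hψ : ContDiff ℝ 2 ψ)
    (hc : HasCompactSupport ψ) {ε : ℝ} (hε : 0 < ε) :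
    ∫ x, ∑ i : Fin 3, ∑ l : Fin 3,
      (weight ε i l x * inner ℝ (fderiv ℝ ψ x (EuclideanSpace.single l 1))
          (A i (A (i + 1) (fderiv ℝ ψ x (EuclideanSpace.single (i + 1) 1)))) -
        weight ε (i + 1) l x * inner ℝ (fderiv ℝ ψ x (EuclideanSpace.single l 1))
          (A i (A (i + 1) (fderiv ℝ ψ x (EuclideanSpace.single i 1))))) = 0 := by
  have hψ1 : ContDiff ℝ 1 ψ := hψ.of_le one_le_two
  have hS : ∀ (i : Fin 3) (u v : E), inner ℝ u ((A i ∘L A (i + 1)) v) =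
      -inner ℝ v ((A i ∘L A (i + 1)) u) := fun i u v => by
    have hi : i + 1 ≠ i := by simp
    rw [ContinuousLinearMap.comp_apply, ContinuousLinearMap.comp_apply, ← hA.symm, ← hA.symm,
      hA.anti _ _ hi, inner_neg_left, real_inner_comm]
  have hI : ∀ i j l k : Fin 3, Integrable fun x =>
      weight ε j l x * inner ℝ (fderiv ℝ ψ x (EuclideanSpace.single l 1))
        (A i (A (i + 1) (fderiv ℝ ψ x (EuclideanSpace.single k 1)))) := fun i j l k =>
    integrable_mul_inner_fderiv hψ1 hc (contDiff_weight hε j l).continuous (A i ∘L A (i + 1)) _ _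
  have hJ : ∀ i j l k : Fin 3, Integrable fun x =>
      2⁻¹ * (fderiv ℝ (weight ε j l) x (EuclideanSpace.single k 1) *
          inner ℝ (ψ x) (A i (A (i + 1) (fderiv ℝ ψ x (EuclideanSpace.single l 1)))) -
        fderiv ℝ (weight ε j l) x (EuclideanSpace.single l 1) *
          inner ℝ (ψ x) (A i (A (i + 1) (fderiv ℝ ψ x (EuclideanSpace.single k 1))))) :=
    fun i j l k =>
    ((integrable_fderiv_mul_inner hψ1 hc (contDiff_weight hε j l) (A i ∘L A (i + 1)) _ _).sub
      (integrable_fderiv_mul_inner hψ1 hc (contDiff_weight hε j l) (A i ∘L A (i + 1))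
        _ _)).const_mul _
  refine (integral_sum_sum_congr (fun i l => (hI i i l (i + 1)).sub (hI i (i + 1) l i))
    (fun i l => (hJ i i l (i + 1)).sub (hJ i (i + 1) l i)) fun i l => ?_).trans ?_
  rotate_left
  · refine integral_eq_zero_of_ae (ae_of_all _ fun x => ?_)
    have h := sum_fderiv_weight_eq_zero hε x fun i l =>
      inner ℝ (ψ x) (A i (A (i + 1) (fderiv ℝ ψ x (EuclideanSpace.single l 1))))
    simp only [Pi.sub_apply, Pi.zero_apply, ← mul_sub, ← Finset.mul_sum] at h ⊢
    rw [h, mul_zero]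
  · have hE : ∀ j k : Fin 3, _ = _ := fun j k =>
      integral_mul_inner_fderiv_antisymm hψ hc (contDiff_weight hε j l) (A i ∘L A (i + 1)) (hS i)
        (EuclideanSpace.single l 1) (EuclideanSpace.single k 1)
    simp only [ContinuousLinearMap.comp_apply] at hE
    refine (integral_sub (hI i i l (i + 1)) (hI i (i + 1) l i)).trans (Eq.trans ?_
      (integral_sub (hJ i i l (i + 1)) (hJ i (i + 1) l i)).symm)
    rw [hE, hE]

/-- The Clifford multiplication by the vector `x`. -/
def cliffordMul (A : Fin 3 → E →L[ℝ] E) (x : E3) : E →L[ℝ] E := ∑ j, x j • A j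

theorem cliffordMul_apply (x : E3) (u : E) : cliffordMul A x u = ∑ j, x j • A j u := by
  simp [cliffordMul]

theorem IsClifford.inner_cliffordMul_left (hA : IsClifford A) (x : E3) (u v : E) :
    inner ℝ (cliffordMul A x u) v = inner ℝ u (cliffordMul A x v) := by
  simp [cliffordMul_apply, sum_inner, inner_sum, inner_smul_left, inner_smul_right, hA.symm]

theorem IsClifford.cliffordMul_sum (hA : IsClifford A) (x : E3) (p : Fin 3 → E) :
    cliffordMul A x (∑ j, A j (p j)) = ∑ j, x j • p j +
      ∑ i : Fin 3, A i (A (i + 1) (x i • p (i + 1) - x (i + 1) • p i)) := by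
  have e1 : (0 : Fin 3) + 1 = 1 := rfl
  have e2 : (1 : Fin 3) + 1 = 2 := rfl
  have e3 : (2 : Fin 3) + 1 = 0 := rfl
  simp only [cliffordMul_apply, Fin.sum_univ_three, map_add, map_sub, map_smul, hA.sq, e1, e2, e3,
    hA.anti 1 0 (by decide), hA.anti 2 1 (by decide), hA.anti 0 2 (by decide)]
  module

theorem IsClifford.cliffordMul_cliffordMul (hA : IsClifford A) (x : E3) (u : E) :
    cliffordMul A x (cliffordMul A x u) = ‖x‖ ^ 2 • u := by
  have h := hA.cliffordMul_sum x fun j => x j • u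
  simp only [map_smul] at h
  rw [cliffordMul_apply x u, h]
  simp [Fin.sum_univ_three, EuclideanSpace.norm_sq_eq]
  module

theorem IsClifford.norm_cliffordMul_sq (hA : IsClifford A) (x : E3) (u : E) :
    ‖cliffordMul A x u‖ ^ 2 = ‖x‖ ^ 2 * ‖u‖ ^ 2 := by
  rw [← real_inner_self_eq_norm_sq, hA.inner_cliffordMul_left, hA.cliffordMul_cliffordMul,
    inner_smul_right, real_inner_self_eq_norm_sq]

theorem IsClifford.norm_apply (hA : IsClifford A) (j : Fin 3) (u : E) : ‖A j u‖ ^ 2 = ‖u‖ ^ 2 := by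
  rw [← real_inner_self_eq_norm_sq, hA.symm, hA.sq, real_inner_self_eq_norm_sq]

theorem IsClifford.norm_sum_sq_le_of_orthogonal (hA : IsClifford A) {x : E3} (hx : x ≠ 0)
    {t : Fin 3 → E} (ht : ∑ j, x j • t j = 0) :
    ‖∑ j, A j (t j)‖ ^ 2 ≤ 2 * ∑ j, ‖t j‖ ^ 2 := by
  set S := ∑ j, A j (t j) with hS
  set Y := cliffordMul A x S with hY
  have hR : 0 < ‖x‖ ^ 2 := by positivity
  have h1 : ∑ j, inner ℝ (t j) (A j S) = ‖S‖ ^ 2 := by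
    rw [← real_inner_self_eq_norm_sq]
    nth_rw 2 [hS]
    simp [sum_inner, hA.symm]
  have h2 : ∑ j, x j * inner ℝ (t j) Y = 0 := by
    have := congrArg (fun z => inner ℝ z Y) ht
    simpa [sum_inner, inner_smul_left] using this
  have h3 : ∑ j, x j * inner ℝ (A j S) Y = ‖x‖ ^ 2 * ‖S‖ ^ 2 := by
    have h : inner ℝ Y Y = ‖x‖ ^ 2 * ‖S‖ ^ 2 := by
      rw [real_inner_self_eq_norm_sq, hY, hA.norm_cliffordMul_sq]
    rw [← h]
    nth_rw 2 [hY]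
    simp [cliffordMul_apply, sum_inner, inner_smul_left]
  have h4 : ‖x‖ ^ 2 = ∑ j, x j ^ 2 := by simp [EuclideanSpace.norm_sq_eq]
  have h5 : ‖Y‖ ^ 2 = ‖x‖ ^ 2 * ‖S‖ ^ 2 := hA.norm_cliffordMul_sq x S
  have h6 : 0 ≤ ∑ j, ‖(2 * ‖x‖ ^ 2) • t j - (‖x‖ ^ 2 • A j S - x j • Y)‖ ^ 2 := by positivity
  have h7 : ∑ j, ‖(2 * ‖x‖ ^ 2) • t j - (‖x‖ ^ 2 • A j S - x j • Y)‖ ^ 2 =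
      (‖x‖ ^ 2) ^ 2 * (4 * ∑ j, ‖t j‖ ^ 2 - 2 * ‖S‖ ^ 2) := by
    have h8 : ∀ j, ‖(2 * ‖x‖ ^ 2) • t j - (‖x‖ ^ 2 • A j S - x j • Y)‖ ^ 2 =
        4 * (‖x‖ ^ 2) ^ 2 * ‖t j‖ ^ 2 - 4 * (‖x‖ ^ 2) ^ 2 * inner ℝ (t j) (A j S) +
        4 * ‖x‖ ^ 2 * (x j * inner ℝ (t j) Y) + (‖x‖ ^ 2) ^ 2 * ‖S‖ ^ 2 -
        2 * ‖x‖ ^ 2 * (x j * inner ℝ (A j S) Y) + x j ^ 2 * ‖Y‖ ^ 2 := fun j => by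
      rw [norm_sub_sq_real, norm_sub_sq_real, inner_sub_right]
      simp only [norm_smul, inner_smul_left, inner_smul_right, mul_pow, Real.norm_eq_abs, sq_abs,
        hA.norm_apply, RCLike.conj_to_real]
      ring
    simp_rw [h8, Finset.sum_add_distrib, Finset.sum_sub_distrib, Finset.sum_add_distrib,
      Finset.sum_sub_distrib, ← Finset.mul_sum, ← Finset.sum_mul, h1, h2, h3, ← h4, h5]
    simp
    ring
  rw [h7] at h6
  have := nonneg_of_mul_nonneg_right h6 (by positivity)
  linarith

theorem IsClifford.pointwise_le (hA : IsClifford A) (x : E3) (p : Fin 3 → E) :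
    ‖x‖ ^ 2 * ‖∑ j, A j (p j)‖ ^ 2 + 3 * ‖∑ j, x j • p j‖ ^ 2 ≤ 2 * ‖x‖ ^ 2 * ∑ j, ‖p j‖ ^ 2 +
      2 * inner ℝ (∑ j, x j • p j) (cliffordMul A x (∑ j, A j (p j))) := by
  rcases eq_or_ne x 0 with rfl | hx
  · simp
  set D := ∑ j, A j (p j) with hD
  set q := ∑ j, x j • p j with hq
  have hR : 0 < ‖x‖ ^ 2 := by positivity
  have h4 : ‖x‖ ^ 2 = ∑ j, x j ^ 2 := by simp [EuclideanSpace.norm_sq_eq]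
  have h1 := hA.norm_sum_sq_le_of_orthogonal hx (t := fun j => ‖x‖ ^ 2 • p j - x j • q) (by
    have h : ∀ j, x j • (‖x‖ ^ 2 • p j - x j • q) = ‖x‖ ^ 2 • (x j • p j) - x j ^ 2 • q :=
      fun j => by module
    simp_rw [h, Finset.sum_sub_distrib, ← Finset.smul_sum, ← Finset.sum_smul, ← h4, ← hq,
      sub_self])
  have h2 : ∑ j, A j (‖x‖ ^ 2 • p j - x j • q) = ‖x‖ ^ 2 • D - cliffordMul A x q := by
    simp_rw [map_sub, map_smul, Finset.sum_sub_distrib, ← Finset.smul_sum, cliffordMul_apply, hD]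
  have h3 : ‖x‖ ^ 2 * ‖‖x‖ ^ 2 • D - cliffordMul A x q‖ ^ 2 =
      (‖x‖ ^ 2) ^ 2 * ‖cliffordMul A x D - q‖ ^ 2 := by
    rw [← hA.norm_cliffordMul_sq, map_sub, map_smul, hA.cliffordMul_cliffordMul, ← smul_sub,
      norm_smul, mul_pow]
    simp
  have h5 : ∑ j, ‖‖x‖ ^ 2 • p j - x j • q‖ ^ 2 =
      (‖x‖ ^ 2) ^ 2 * ∑ j, ‖p j‖ ^ 2 - ‖x‖ ^ 2 * ‖q‖ ^ 2 := by
    have h6 : ∀ j, ‖‖x‖ ^ 2 • p j - x j • q‖ ^ 2 = (‖x‖ ^ 2) ^ 2 * ‖p j‖ ^ 2 -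
        2 * ‖x‖ ^ 2 * (x j * inner ℝ (p j) q) + x j ^ 2 * ‖q‖ ^ 2 := fun j => by
      rw [norm_sub_sq_real]
      simp only [norm_smul, inner_smul_left, inner_smul_right, mul_pow, Real.norm_eq_abs, sq_abs,
        RCLike.conj_to_real]
      simp
      ring
    have h7 : ∑ j, x j * inner ℝ (p j) q = ‖q‖ ^ 2 := by
      rw [← real_inner_self_eq_norm_sq]
      nth_rw 2 [hq]
      simp [sum_inner, inner_smul_left]
    simp_rw [h6, Finset.sum_add_distrib, Finset.sum_sub_distrib, ← Finset.mul_sum,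
      ← Finset.sum_mul, h7, ← h4]
    ring
  rw [h2, h5] at h1
  have h8 := mul_le_mul_of_nonneg_left h1 hR.le
  rw [h3, norm_sub_sq_real, hA.norm_cliffordMul_sq, real_inner_comm] at h8
  refine le_of_mul_le_mul_left ?_ (pow_pos hR 2)
  linarith

theorem IsClifford.sum_weight_eq (hA : IsClifford A) (ε : ℝ) (x : E3) (p : Fin 3 → E) :
    ∑ i : Fin 3, ∑ l : Fin 3,
      (weight ε i l x * inner ℝ (p l) (A i (A (i + 1) (p (i + 1)))) -
        weight ε (i + 1) l x * inner ℝ (p l) (A i (A (i + 1) (p i)))) =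
    regInv ε x * ((‖x‖ ^ 2 + ε ^ 2 / 2) * (‖∑ j, A j (p j)‖ ^ 2 - ∑ j, ‖p j‖ ^ 2) -
      (inner ℝ (∑ j, x j • p j) (cliffordMul A x (∑ j, A j (p j))) -
        ‖∑ j, x j • p j‖ ^ 2)) := by
  rw [hA.cliffordMul_sum, inner_add_right, real_inner_self_eq_norm_sq,
    ← real_inner_self_eq_norm_sq (∑ j, A j (p j))]
  have e1 : (0 : Fin 3) + 1 = 1 := rfl
  have e2 : (1 : Fin 3) + 1 = 2 := rfl
  have e3 : (2 : Fin 3) + 1 = 0 := rfl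
  simp only [weight, Fin.sum_univ_three, map_sub, map_smul, hA.sq, e1, e2, e3,
    hA.anti 1 0 (by decide), hA.anti 2 1 (by decide), hA.anti 0 2 (by decide), inner_add_left,
    inner_add_right, inner_sub_right, inner_smul_left, inner_smul_right, hA.symm, inner_neg_right,
    real_inner_self_eq_norm_sq, RCLike.conj_to_real]
  simp [Matrix.one_apply]
  ring

theorem fderiv_apply_self_eq_sum (ψ : E3 → E) (x : E3) :
    fderiv ℝ ψ x x = ∑ j, x j • fderiv ℝ ψ x (EuclideanSpace.single j 1) := by
  have h : x = ∑ j, x j • EuclideanSpace.single j (1 : ℝ) := by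
    ext i
    simp [Pi.single_apply]
  have h1 := congrArg (fderiv ℝ ψ x) h
  simpa only [map_sum, map_smul] using h1

theorem fderiv_regInv_mul_coord {ε : ℝ} (hε : 0 < ε) (l : Fin 3) (x : E3) :
    fderiv ℝ (fun y => regInv ε y * y l) x (EuclideanSpace.single l 1) =
      regInv ε x - regInv ε x ^ 3 * x l ^ 2 := by
  have h : HasFDerivAt (fun x : E3 => x l) (EuclideanSpace.proj (𝕜 := ℝ) l) x :=
    (EuclideanSpace.proj (𝕜 := ℝ) l).hasFDerivAt
  have h1 := ((contDiff_regInv hε).differentiable one_ne_zero x).hasFDerivAt.mul h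
  have h2 : fderiv ℝ (fun y => regInv ε y * y l) x = _ := h1.fderiv
  rw [h2]
  simp [fderiv_regInv hε, EuclideanSpace.inner_single_right]
  ring

theorem integral_regInv_mul_radial_eq_zero {ψ : E3 → E} (hψ : ContDiff ℝ 1 ψ)
    (hc : HasCompactSupport ψ) {ε : ℝ} (hε : 0 < ε) :
    ∫ x, ((3 * regInv ε x - regInv ε x ^ 3 * ‖x‖ ^ 2) * ‖ψ x‖ ^ 2 +
      2 * (regInv ε x * inner ℝ (ψ x) (fderiv ℝ ψ x x))) = 0 := by
  have hW : ∀ l : Fin 3, ContDiff ℝ 1 fun y : E3 => regInv ε y * y l := fun l =>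
    (contDiff_regInv hε).mul (EuclideanSpace.proj (𝕜 := ℝ) l).contDiff
  have hg : ContDiff ℝ 1 fun y => ‖ψ y‖ ^ 2 := hψ.norm_sq ℝ
  have hgc : HasCompactSupport fun y => ‖ψ y‖ ^ 2 :=
    hc.mono fun x hx h0 => hx (by simp [h0])
  have hF : ∀ l : Fin 3, Integrable fun x : E3 => fderiv ℝ (fun y => regInv ε y * y l) x
      (EuclideanSpace.single l 1) * ‖ψ x‖ ^ 2 := fun l =>
    ((((hW l).continuous_fderiv one_ne_zero).clm_apply continuous_const).mul
      hg.continuous).integrable_of_hasCompactSupport hgc.mul_left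
  have hG : ∀ l : Fin 3, Integrable fun x : E3 => regInv ε x * x l *
      fderiv ℝ (fun y => ‖ψ y‖ ^ 2) x (EuclideanSpace.single l 1) := fun l =>
    ((hW l).continuous.mul ((hg.continuous_fderiv one_ne_zero).clm_apply
      continuous_const)).integrable_of_hasCompactSupport (hgc.fderiv_apply (𝕜 := ℝ) _).mul_left
  have h : ∀ x, (3 * regInv ε x - regInv ε x ^ 3 * ‖x‖ ^ 2) * ‖ψ x‖ ^ 2 +
      2 * (regInv ε x * inner ℝ (ψ x) (fderiv ℝ ψ x x)) =
      ∑ l : Fin 3, (fderiv ℝ (fun y => regInv ε y * y l) x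
        (EuclideanSpace.single l 1) * ‖ψ x‖ ^ 2 + regInv ε x * x l *
          fderiv ℝ (fun y => ‖ψ y‖ ^ 2) x (EuclideanSpace.single l 1)) := fun x => by
    rw [((hψ.differentiable one_ne_zero x).hasFDerivAt.norm_sq).fderiv, fderiv_apply_self_eq_sum,
      EuclideanSpace.norm_sq_eq]
    simp only [fderiv_regInv_mul_coord hε]
    simp [Fin.sum_univ_three, inner_add_right, inner_smul_right]
    ring
  simp_rw [h]
  refine (integral_finsetSum _ fun l _ => (hF l).add (hG l)).trans
    (Finset.sum_eq_zero fun l _ => (integral_add (hF l) (hG l)).trans ?_)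
  rw [integral_mul_fderiv_of_compact (hW l) hg hgc, add_neg_cancel]

theorem integral_regInv_mul_norm_sq_le {ψ : E3 → E} (hψ : ContDiff ℝ 1 ψ)
    (hc : HasCompactSupport ψ) {ε : ℝ} (hε : 0 < ε) :
    ∫ x, regInv ε x * ‖ψ x‖ ^ 2 ≤ ∫ x, regInv ε x * ‖fderiv ℝ ψ x x‖ ^ 2 := by
  have hf : Continuous (regInv ε) := (contDiff_regInv hε).continuous
  have hq : Continuous fun x => fderiv ℝ ψ x x :=
    (hψ.continuous_fderiv one_ne_zero).clm_apply continuous_id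
  have hi1 : Integrable fun x => regInv ε x * ‖ψ x‖ ^ 2 :=
    (hf.mul (hψ.continuous.norm.pow 2)).integrable_of_hasCompactSupport
      (hc.mono fun x hx h0 => hx (by simp [h0]))
  have hi2 : Integrable fun x => regInv ε x * ‖fderiv ℝ ψ x x‖ ^ 2 :=
    (hf.mul (hq.norm.pow 2)).integrable_of_hasCompactSupport
      ((hc.fderiv (𝕜 := ℝ)).mono fun x hx h0 => hx (by simp [h0]))
  have hi3 : Integrable fun x => (3 * regInv ε x - regInv ε x ^ 3 * ‖x‖ ^ 2) * ‖ψ x‖ ^ 2 +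
      2 * (regInv ε x * inner ℝ (ψ x) (fderiv ℝ ψ x x)) := by
    refine Continuous.integrable_of_hasCompactSupport ?_
      (hc.mono fun x hx h0 => hx (by simp [h0]))
    have := hψ.continuous
    fun_prop
  rw [← add_zero (∫ x, regInv ε x * ‖fderiv ℝ ψ x x‖ ^ 2),
    ← integral_regInv_mul_radial_eq_zero hψ hc hε, ← integral_add hi2 hi3]
  refine integral_mono hi1 (hi2.add hi3) fun x => ?_
  have h1 := regInv_sq_mul hε x
  have h2 := regInv_pos hε x
  have h3 : 0 ≤ ‖ψ x + fderiv ℝ ψ x x‖ ^ 2 := by positivity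
  rw [norm_add_sq_real] at h3
  have h4 : regInv ε x ^ 3 * ‖x‖ ^ 2 = regInv ε x - regInv ε x ^ 3 * ε ^ 2 := by
    linear_combination regInv ε x * h1
  have h5 : 0 ≤ regInv ε x ^ 3 * ε ^ 2 * ‖ψ x‖ ^ 2 := by positivity
  have h6 := mul_nonneg h2.le h3
  simp only [h4]
  linarith

theorem IsClifford.integral_regInv_le (hA : IsClifford A) {ψ : E3 → E} (hψ : ContDiff ℝ 2 ψ)
    (hc : HasCompactSupport ψ) {ε : ℝ} (hε : 0 < ε) :
    ∫ x, regInv ε x * ‖ψ x‖ ^ 2 ≤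
      (∫ x, ‖x‖ * ‖∑ j, A j (fderiv ℝ ψ x (EuclideanSpace.single j 1))‖ ^ 2) +
      ε * ∫ x, ‖∑ j, A j (fderiv ℝ ψ x (EuclideanSpace.single j 1))‖ ^ 2 := by
  have hψ1 : ContDiff ℝ 1 ψ := hψ.of_le one_le_two
  refine (integral_regInv_mul_norm_sq_le hψ1 hc hε).trans ?_
  have hf : Continuous (regInv ε) := (contDiff_regInv hε).continuous
  have hp : Continuous (fderiv ℝ ψ) := hψ1.continuous_fderiv one_ne_zero
  have hpc := hc.fderiv (𝕜 := ℝ)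
  have hD : Continuous fun x => ∑ j, A j (fderiv ℝ ψ x (EuclideanSpace.single j 1)) := by
    fun_prop
  have hi1 : Integrable fun x : E3 =>
      ‖x‖ * ‖∑ j, A j (fderiv ℝ ψ x (EuclideanSpace.single j 1))‖ ^ 2 :=
    (continuous_norm.mul (hD.norm.pow 2)).integrable_of_hasCompactSupport
      (hpc.mono fun x hx h0 => hx (by simp [h0]))
  have hi2 : Integrable fun x =>
      ‖∑ j, A j (fderiv ℝ ψ x (EuclideanSpace.single j 1))‖ ^ 2 :=
    (hD.norm.pow 2).integrable_of_hasCompactSupport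
      (hpc.mono fun x hx h0 => hx (by simp [h0]))
  have hi3 : Integrable fun x => regInv ε x * ‖fderiv ℝ ψ x x‖ ^ 2 :=
    (hf.mul ((hp.clm_apply continuous_id).norm.pow 2)).integrable_of_hasCompactSupport
      (hpc.mono fun x hx h0 => hx (by simp [h0]))
  have hi4 : Integrable fun x => ∑ i : Fin 3, ∑ l : Fin 3,
      (weight ε i l x * inner ℝ (fderiv ℝ ψ x (EuclideanSpace.single l 1))
          (A i (A (i + 1) (fderiv ℝ ψ x (EuclideanSpace.single (i + 1) 1)))) -
        weight ε (i + 1) l x * inner ℝ (fderiv ℝ ψ x (EuclideanSpace.single l 1))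
          (A i (A (i + 1) (fderiv ℝ ψ x (EuclideanSpace.single i 1))))) :=
    integrable_finsetSum Finset.univ fun i _ => integrable_finsetSum Finset.univ fun l _ =>
      (integrable_mul_inner_fderiv hψ1 hc (contDiff_weight hε i l).continuous (A i ∘L A (i + 1))
        (EuclideanSpace.single l 1) (EuclideanSpace.single (i + 1) 1)).sub
      (integrable_mul_inner_fderiv hψ1 hc (contDiff_weight hε (i + 1) l).continuous
        (A i ∘L A (i + 1)) (EuclideanSpace.single l 1) (EuclideanSpace.single i 1))
  have h0 := integral_add hi3 (hi4.const_mul 2)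
  rw [integral_const_mul, hA.integral_eq_zero hψ hc hε, mul_zero, add_zero] at h0
  rw [← integral_const_mul, ← integral_add hi1 (hi2.const_mul ε), ← h0]
  refine integral_mono (hi3.add (hi4.const_mul 2)) (hi1.add (hi2.const_mul ε)) fun x => ?_
  have h1 := hA.sum_weight_eq ε x fun j => fderiv ℝ ψ x (EuclideanSpace.single j 1)
  have h2 := hA.pointwise_le x fun j => fderiv ℝ ψ x (EuclideanSpace.single j 1)
  have h3 := regInv_pos hε x
  have h4 : regInv ε x * (‖x‖ ^ 2 + ε ^ 2) ≤ ‖x‖ + ε := by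
    rw [regInv, inv_mul_eq_div, Real.div_sqrt, Real.sqrt_le_left (by positivity)]
    nlinarith [norm_nonneg x]
  rw [h1, fderiv_apply_self_eq_sum]
  have h5 := mul_le_mul_of_nonneg_left h2 h3.le
  have h6 := mul_le_mul_of_nonneg_right h4
    (sq_nonneg ‖∑ j, A j (fderiv ℝ ψ x (EuclideanSpace.single j 1))‖)
  have h7 : 0 ≤ regInv ε x * ε ^ 2 * ∑ j, ‖fderiv ℝ ψ x (EuclideanSpace.single j 1)‖ ^ 2 := by
    positivity
  linarith

theorem tendsto_regInv {x : E3} (hx : x ≠ 0) :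
    Tendsto (fun n : ℕ => regInv (1 / ((n : ℝ) + 1)) x) atTop (nhds ‖x‖⁻¹) := by
  have h := ((((tendsto_one_div_add_atTop_nhds_zero_nat (𝕜 := ℝ)).pow 2).const_add
    (‖x‖ ^ 2)).sqrt).inv₀ (by simpa using hx)
  simpa [regInv] using h

/-- The Hardy inequality for the Dirac operator attached to a Clifford system. -/
theorem IsClifford.integrable_and_integral_le (hA : IsClifford A) {ψ : E3 → E}
    (hψ : ContDiff ℝ 2 ψ) (hc : HasCompactSupport ψ) :
    Integrable (fun x : E3 => ‖ψ x‖ ^ 2 / ‖x‖) ∧ ∫ x : E3, ‖ψ x‖ ^ 2 / ‖x‖ ≤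
      ∫ x, ‖x‖ * ‖∑ j, A j (fderiv ℝ ψ x (EuclideanSpace.single j 1))‖ ^ 2 := by
  set I := ∫ x, ‖x‖ * ‖∑ j, A j (fderiv ℝ ψ x (EuclideanSpace.single j 1))‖ ^ 2 with hI
  set J := ∫ x, ‖∑ j, A j (fderiv ℝ ψ x (EuclideanSpace.single j 1))‖ ^ 2
  have hI0 : 0 ≤ I := integral_nonneg fun x => by positivity
  have hpos : ∀ n : ℕ, 0 < 1 / ((n : ℝ) + 1) := fun n => by positivity
  have hcont : ∀ n : ℕ, Continuous fun x => regInv (1 / ((n : ℝ) + 1)) x * ‖ψ x‖ ^ 2 := fun n =>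
    (contDiff_regInv (hpos n)).continuous.mul (hψ.continuous.norm.pow 2)
  have hlim : Tendsto (fun n : ℕ => ENNReal.ofReal (I + 1 / ((n : ℝ) + 1) * J)) atTop
      (nhds (ENNReal.ofReal I)) := by
    refine ENNReal.tendsto_ofReal ?_
    simpa using ((tendsto_one_div_add_atTop_nhds_zero_nat (𝕜 := ℝ)).mul_const J).const_add I
  have hbound : ∫⁻ x : E3, ENNReal.ofReal (‖ψ x‖ ^ 2 / ‖x‖) ≤ ENNReal.ofReal I := calc
    _ = ∫⁻ x : E3, liminf (fun n : ℕ =>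
        ENNReal.ofReal (regInv (1 / ((n : ℝ) + 1)) x * ‖ψ x‖ ^ 2)) atTop := by
      refine lintegral_congr_ae ?_
      filter_upwards [Measure.ae_ne volume (0 : E3)] with x hx
      have h := (tendsto_regInv hx).mul_const (‖ψ x‖ ^ 2)
      rw [(ENNReal.tendsto_ofReal h).liminf_eq, div_eq_inv_mul]
    _ ≤ liminf (fun n : ℕ =>
        ∫⁻ x, ENNReal.ofReal (regInv (1 / ((n : ℝ) + 1)) x * ‖ψ x‖ ^ 2)) atTop :=
      lintegral_liminf_le fun n => (hcont n).measurable.ennreal_ofReal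
    _ ≤ liminf (fun n : ℕ => ENNReal.ofReal (I + 1 / ((n : ℝ) + 1) * J)) atTop := by
      refine liminf_le_liminf (Eventually.of_forall fun n => ?_)
      rw [← ofReal_integral_eq_lintegral_ofReal
        ((hcont n).integrable_of_hasCompactSupport (hc.mono fun x hx h0 => hx (by simp [h0])))
        (ae_of_all _ fun x => mul_nonneg (regInv_pos (hpos n) x).le (sq_nonneg _))]
      exact ENNReal.ofReal_le_ofReal (hA.integral_regInv_le hψ hc (hpos n))
    _ = ENNReal.ofReal I := hlim.liminf_eq
  have hmeas : AEStronglyMeasurable (fun x : E3 => ‖ψ x‖ ^ 2 / ‖x‖) volume :=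
    ((hψ.continuous.norm.pow 2).measurable.div measurable_norm).aestronglyMeasurable
  have hnn : 0 ≤ᵐ[volume] fun x : E3 => ‖ψ x‖ ^ 2 / ‖x‖ := ae_of_all _ fun x => by positivity
  refine ⟨⟨hmeas, ?_⟩, ?_⟩
  · rw [hasFiniteIntegral_iff_ofReal hnn]
    exact hbound.trans_lt ENNReal.ofReal_lt_top
  · rw [integral_eq_lintegral_of_nonneg_ae hnn hmeas]
    exact ENNReal.toReal_le_of_le_ofReal hI0 hbound

end Dirac

theorem pauli_isHermitian (j : Fin 3) : (pauli j).IsHermitian := by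
  ext a b
  fin_cases j <;> fin_cases a <;> fin_cases b <;> simp [pauli]

theorem pauli_mul_self (j : Fin 3) : pauli j * pauli j = 1 := by
  ext a b
  fin_cases j <;> fin_cases a <;> fin_cases b <;> simp [pauli, Matrix.mul_apply]

theorem pauli_mul_comm {j k : Fin 3} (h : j ≠ k) : pauli j * pauli k = -(pauli k * pauli j) := by
  ext a b
  fin_cases j <;> fin_cases k <;> fin_cases a <;> fin_cases b <;>
    simp [pauli, Matrix.mul_apply] at h ⊢

theorem diracAlpha_isHermitian (j : Fin 3) : (diracAlpha j).IsHermitian := by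
  have h := pauli_isHermitian j
  unfold Matrix.IsHermitian at h ⊢
  simp [diracAlpha, Matrix.conjTranspose_submatrix, Matrix.fromBlocks_conjTranspose, h]

theorem diracAlpha_mul (j k : Fin 3) : diracAlpha j * diracAlpha k =
    Matrix.reindex finSumFinEquiv finSumFinEquiv
      (Matrix.fromBlocks (pauli j * pauli k) 0 0 (pauli j * pauli k)) := by
  simp [diracAlpha, Matrix.submatrix_mul_equiv, Matrix.fromBlocks_multiply]

theorem diracAlpha_mul_self (j : Fin 3) : diracAlpha j * diracAlpha j = 1 := by
  simp [diracAlpha_mul, pauli_mul_self]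

theorem diracAlpha_mul_comm {j k : Fin 3} (h : j ≠ k) :
    diracAlpha j * diracAlpha k = -(diracAlpha k * diracAlpha j) := by
  have h1 := Matrix.fromBlocks_neg (pauli k * pauli j) 0 0 (pauli k * pauli j)
  rw [neg_zero] at h1
  rw [diracAlpha_mul, diracAlpha_mul, pauli_mul_comm h, ← h1]
  rfl

/-- The Dirac matrices as real-linear operators. -/
def diracCLM (j : Fin 3) : C4 →L[ℝ] C4 :=
  (Matrix.toEuclideanCLM (𝕜 := ℂ) (diracAlpha j)).restrictScalars ℝ

theorem diracCLM_diracCLM (j k : Fin 3) (u : C4) : diracCLM j (diracCLM k u) =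
    Matrix.toEuclideanCLM (𝕜 := ℂ) (diracAlpha j * diracAlpha k) u := by
  simp [diracCLM]

theorem isClifford_diracCLM : IsClifford diracCLM where
  symm j u v := by
    have h := Matrix.isSymmetric_toEuclideanLin_iff.2 (diracAlpha_isHermitian j) u v
    have hre : ∀ a b : C4, inner ℝ a b = (inner ℂ a b).re := fun a b => by
      simp [PiLp.inner_apply]
    rw [hre, hre]
    exact congrArg Complex.re h
  sq j u := by simp [diracCLM_diracCLM, diracAlpha_mul_self]
  anti j k h u := by simp [diracCLM_diracCLM, diracAlpha_mul_comm h]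

theorem norm_diracD (ψ : E3 → C4) (x : E3) :
    ‖diracD ψ x‖ = ‖∑ j, diracCLM j (fderiv ℝ ψ x (EuclideanSpace.single j 1))‖ := by
  rw [diracD, norm_smul, norm_neg, Complex.norm_I, one_mul]
  rfl

theorem norm_mulVecE_le (M : Matrix (Fin 4) (Fin 4) ℂ) (u : C4) :
    ‖mulVecE M u‖ ≤ ‖Matrix.toEuclideanCLM (𝕜 := ℂ) M‖ * ‖u‖ :=
  (Matrix.toEuclideanCLM (𝕜 := ℂ) M).le_opNorm u

/-- coercivity of the quadratic form for subcritical potentials. -/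
theorem quadratic_form_coercive (v : ℝ) (hv0 : 0 ≤ v) (hv1 : v < 1)
    (V : E3 → Matrix (Fin 4) (Fin 4) ℂ) (hVmeas : ∀ i j, Measurable fun x => V x i j)
    (hV : ∀ᵐ x : E3, (V x).IsHermitian ∧ ‖x‖ * ‖Matrix.toEuclideanCLM (𝕜 := ℂ) (V x)‖ ≤ v)
    (ψ : E3 → C4) (hsmooth : ContDiff ℝ (⊤ : ℕ∞) ψ) (hsupp : HasCompactSupport ψ) :
    (∫ x : E3, ‖x‖ * ‖diracD ψ x‖ ^ 2) - (∫ x : E3, ‖x‖ * ‖mulVecE (V x) (ψ x)‖ ^ 2) ≥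
      (1 - v ^ 2) * ∫ x : E3, ‖ψ x‖ ^ 2 / ‖x‖ := by
  obtain ⟨hint, hle⟩ := isClifford_diracCLM.integrable_and_integral_le
    (hsmooth.of_le (WithTop.coe_le_coe.2 le_top)) hsupp
  simp_rw [← norm_diracD] at hle
  have hpot : ∫ x : E3, ‖x‖ * ‖mulVecE (V x) (ψ x)‖ ^ 2 ≤
      ∫ x : E3, v ^ 2 * (‖ψ x‖ ^ 2 / ‖x‖) := by
    refine integral_mono_of_nonneg (ae_of_all _ fun x => by positivity) (hint.const_mul _) ?_
    filter_upwards [hV, Measure.ae_ne volume (0 : E3)] with x hx hx0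
    have hx1 : 0 < ‖x‖ := norm_pos_iff.2 hx0
    rw [← mul_div_assoc, le_div_iff₀ hx1]
    calc ‖x‖ * ‖mulVecE (V x) (ψ x)‖ ^ 2 * ‖x‖ = (‖x‖ * ‖mulVecE (V x) (ψ x)‖) ^ 2 := by ring
      _ ≤ (v * ‖ψ x‖) ^ 2 := by
        refine pow_le_pow_left₀ (by positivity) ?_ 2
        calc _ ≤ ‖x‖ * (‖Matrix.toEuclideanCLM (𝕜 := ℂ) (V x)‖ * ‖ψ x‖) := by
              exact mul_le_mul_of_nonneg_left (norm_mulVecE_le _ _) hx1.le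
          _ ≤ v * ‖ψ x‖ := by
            rw [← mul_assoc]
            exact mul_le_mul_of_nonneg_right hx.2 (norm_nonneg _)
      _ = v ^ 2 * ‖ψ x‖ ^ 2 := by ring
  rw [integral_const_mul] at hpot
  linarith
end
end
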